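/- arXiv:1503.08790 — 2 statements merged into one kernel-verified Lean document; each statement's English description precedes it below -/
import Mathlib

section
/- Local limit theorem for the height of admissible walks on ℕ₀: define φ(η) = (4η/π) Σ_{k≥0} (−1)^k (2k+1) exp(−(2k+1)²η²/2) for η > 0. For every ε > 0 there exists N such that for all n ≥ N and all integers h with h ≡ n (mod 2) and 3/√(log n) < h/√n < √(log n)/2, one has |√n · P(H_n = h)/(2φ(h/√n)) − 1| < ε, where P(H_n = h) = V(n,h)/(Σ_{h'≥0} V(n,h')). -/
open Real

/-- Partial sum `S_k` of the `±1`-walk encoded by `ε : Fin n → Bool`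
(`true` = step `+1`, `false` = step `-1`). -/
def walkSum (n : ℕ) (ε : Fin n → Bool) (k : ℕ) : ℤ :=
  ∑ i : Fin n, if (i : ℕ) < k then (if ε i then 1 else -1) else 0

/-- `V n h`: number of `±1`-paths of length `n` with `|S_k| ≤ h` for all `k` and `|S_n| = h`. -/
noncomputable def V (n h : ℕ) : ℕ :=
  Nat.card {ε : Fin n → Bool //
    (∀ k ≤ n, |walkSum n ε k| ≤ (h : ℤ)) ∧ |walkSum n ε n| = (h : ℤ)}

/-- The limiting density `φ(η) = (4η/π) Σ_{k≥0} (−1)^k (2k+1) exp(−(2k+1)²η²/2)`. -/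
noncomputable def phiDensity (η : ℝ) : ℝ :=
  4 * η / π *
    ∑' k : ℕ, (-1 : ℝ) ^ k * (2 * (k : ℝ) + 1) *
      Real.exp (-((2 * (k : ℝ) + 1) ^ 2 * η ^ 2 / 2))

lemma walkSum_snoc_le (n : ℕ) (ε : Fin n → Bool) (b : Bool) (k : ℕ) (hk : k ≤ n) :
    walkSum (n+1) (Fin.snoc (α := fun _ => Bool) ε b) k = walkSum n ε k := by
  unfold walkSum
  rw [Fin.sum_univ_castSucc]
  simp [not_lt.mpr hk]

lemma walkSum_snoc_last (n : ℕ) (ε : Fin n → Bool) (b : Bool) :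
    walkSum (n+1) (Fin.snoc (α := fun _ => Bool) ε b) (n+1)
      = walkSum n ε n + (if b then 1 else -1) := by
  unfold walkSum
  rw [Fin.sum_univ_castSucc]
  simp

open Classical in
/-- Number of admissible walks in the strip ending at `x`. -/
noncomputable def cnt (n h : ℕ) (x : ℤ) : ℕ :=
  ∑ ε : Fin n → Bool, if (∀ k ≤ n, |walkSum n ε k| ≤ (h : ℤ)) ∧ walkSum n ε n = x then 1 else 0

lemma cnt_succ (n h : ℕ) (x : ℤ) (hx : |x| ≤ h) :
    cnt (n+1) h x = cnt n h (x-1) + cnt n h (x+1) := by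
  classical
  unfold cnt
  rw [← (Fin.snocEquiv (fun _ : Fin (n+1) => Bool)).sum_comp, Fintype.sum_prod_type]
  rw [Fintype.sum_bool]
  have key : ∀ (b : Bool) (ε : Fin n → Bool),
      ((∀ k ≤ n+1, |walkSum (n+1) ((Fin.snocEquiv (fun _ : Fin (n+1) => Bool)) (b, ε)) k| ≤ (h : ℤ)) ∧
        walkSum (n+1) ((Fin.snocEquiv (fun _ : Fin (n+1) => Bool)) (b, ε)) (n+1) = x) ↔
      ((∀ k ≤ n, |walkSum n ε k| ≤ (h : ℤ)) ∧ walkSum n ε n = x - (if b then 1 else -1)) := by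
    intro b ε
    have e : (Fin.snocEquiv (fun _ : Fin (n+1) => Bool)) (b, ε)
      = Fin.snoc (α := fun _ => Bool) ε b := rfl
    rw [e, walkSum_snoc_last]
    constructor
    · rintro ⟨h1, h2⟩
      refine ⟨fun k hk => ?_, by omega⟩
      have := h1 k (by omega)
      rwa [walkSum_snoc_le n ε b k hk] at this
    · rintro ⟨h1, h2⟩
      have h3 : walkSum n ε n + (if b then 1 else -1) = x := by omega
      refine ⟨fun k hk => ?_, h3⟩
      rcases Nat.lt_or_ge n k with h4 | h4
      · have : k = n + 1 := by omega
        rw [this, walkSum_snoc_last, h3]; exact hx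
      · rw [walkSum_snoc_le n ε b k h4]; exact h1 k h4
  simp only [key]
  simp

lemma cnt_zero_of (n h : ℕ) (x : ℤ) (hx : (h:ℤ) < |x|) : cnt n h x = 0 := by
  classical
  unfold cnt
  apply Finset.sum_eq_zero
  intro ε _
  rw [if_neg]
  rintro ⟨h1, h2⟩
  have := h1 n le_rfl
  rw [h2] at this
  omega

lemma cnt_base (h : ℕ) (x : ℤ) : cnt 0 h x = if x = 0 then 1 else 0 := by
  classical
  unfold cnt
  by_cases hx : x = 0
  · simp [walkSum, hx]
  · simp [walkSum, hx, Ne.symm hx]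

lemma V_eq_cnt (n h : ℕ) (hh : 1 ≤ h) : V n h = cnt n h h + cnt n h (-h) := by
  classical
  unfold V cnt
  rw [Nat.card_eq_fintype_card, Fintype.card_subtype, Finset.card_filter, ← Finset.sum_add_distrib]
  apply Finset.sum_congr rfl
  intro ε _
  have h2 : |walkSum n ε n| = (h:ℤ) ↔ walkSum n ε n = h ∨ walkSum n ε n = -h := by
    rw [abs_eq (by positivity)]
  by_cases hA : ∀ k ≤ n, |walkSum n ε k| ≤ (h : ℤ)
  · have hA' : (∀ k ≤ n, |walkSum n ε k| ≤ (h : ℤ)) = True := by simpa using hA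
    simp only [hA', h2, true_and]
    split_ifs <;> omega
  · simp [hA]

lemma V_zero_eq (n : ℕ) : V n 0 = cnt n 0 0 := by
  classical
  unfold V cnt
  rw [Nat.card_eq_fintype_card, Fintype.card_subtype, Finset.card_filter]
  apply Finset.sum_congr rfl
  intro ε _
  simp

/-- The frequencies. -/
noncomputable def th (h k : ℕ) : ℝ := π * (2 * (k:ℝ) + 1) / (2 * ((h:ℝ) + 1))

lemma sum_cos_odd (α : ℝ) (m : ℕ) :
    2 * Real.sin α * ∑ k ∈ Finset.range m, Real.cos ((2*(k:ℝ)+1) * α) = Real.sin (2 * m * α) := by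
  induction m with
  | zero => simp
  | succ m ih =>
    rw [Finset.sum_range_succ, mul_add, ih]
    have h1 : 2 * ((m+1:ℕ):ℝ) * α = (2*(m:ℝ)+1) * α + α := by push_cast; ring
    have h2 : 2 * (m:ℝ) * α = (2*(m:ℝ)+1) * α - α := by ring
    rw [h1, h2, Real.sin_add, Real.sin_sub]; ring

lemma cnt_formula (n h : ℕ) : ∀ x : ℤ, |x| ≤ h + 1 →
    (cnt n h x : ℝ) = (1/((h:ℝ)+1)) *
      ∑ k ∈ Finset.range (h+1), (2 * Real.cos (th h k))^n * Real.cos (th h k * x) := by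
  have hpos : (0:ℝ) < (h:ℝ)+1 := by positivity
  have hbd : ∀ n : ℕ, ∀ x : ℤ, |x| = h + 1 →
      ∑ k ∈ Finset.range (h+1), (2 * Real.cos (th h k))^n * Real.cos (th h k * x) = 0 := by
    intro n x hx
    apply Finset.sum_eq_zero
    intro k _
    have hc : Real.cos (th h k * ((h:ℝ)+1)) = 0 := by
      rw [Real.cos_eq_zero_iff]
      refine ⟨k, ?_⟩
      unfold th
      push_cast
      field_simp
    have : Real.cos (th h k * x) = 0 := by
      rcases (abs_eq (by positivity)).1 hx with h1 | h1
      · rw [h1]; push_cast; exact hc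
      · rw [h1]; push_cast
        rw [show th h k * -((h:ℝ)+1) = -(th h k * ((h:ℝ)+1)) by ring, Real.cos_neg]
        exact hc
    rw [this, mul_zero]
  induction n with
  | zero =>
    intro x hx
    rcases eq_or_lt_of_le hx with h1 | h1
    · rw [hbd 0 x h1, cnt_zero_of _ _ _ (by omega)]; simp
    · rw [cnt_base]
      by_cases hx0 : x = 0
      · subst hx0
        simp
        field_simp
      · rw [if_neg hx0]
        set α : ℝ := π * x / (2 * ((h:ℝ)+1)) with hα
        have hs := sum_cos_odd α (h+1)
        have h2 : Real.sin (2 * ((h+1:ℕ):ℝ) * α) = 0 := by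
          rw [show 2 * ((h+1:ℕ):ℝ) * α = x * π by rw [hα]; push_cast; field_simp]
          exact Real.sin_int_mul_pi x
        rw [h2] at hs
        have hx1 : |(x:ℝ)| < h + 1 := by exact_mod_cast h1
        have h3 : Real.sin α ≠ 0 := by
          rw [abs_lt] at hx1
          have hx0' : (x:ℝ) ≠ 0 := by exact_mod_cast hx0
          have hα0 : α ≠ 0 := by
            rw [hα]
            have := Real.pi_pos
            positivity
          intro hsin
          rw [Real.sin_eq_zero_iff_of_lt_of_lt] at hsin
          · exact hα0 hsin
          · rw [hα, lt_div_iff₀ (by positivity)]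
            nlinarith [Real.pi_pos]
          · rw [hα, div_lt_iff₀ (by positivity)]
            nlinarith [Real.pi_pos]
        have h4 : ∑ k ∈ Finset.range (h+1), Real.cos ((2*(k:ℝ)+1) * α) = 0 := by
          rcases mul_eq_zero.1 hs with h5 | h5
          · exfalso; apply h3; linarith
          · exact h5
        have h6 : ∀ k : ℕ, th h k * x = (2*(k:ℝ)+1) * α := by
          intro k; unfold th; rw [hα]; field_simp
        simp only [pow_zero, one_mul, h6, h4]
        simp
  | succ n ih =>
    intro x hx
    rcases eq_or_lt_of_le hx with h1 | h1
    · rw [hbd _ x h1, cnt_zero_of _ _ _ (by omega)]; simp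
    · rw [cnt_succ n h x (by omega)]
      push_cast
      rw [ih (x-1) (by rw [abs_le] at *; rw [abs_lt] at h1; omega),
        ih (x+1) (by rw [abs_le] at *; rw [abs_lt] at h1; omega), ← mul_add, ← Finset.sum_add_distrib]
      congr 1
      apply Finset.sum_congr rfl
      intro k _
      push_cast
      rw [show th h k * ((x:ℝ)-1) = th h k * x - th h k by ring,
        show th h k * ((x:ℝ)+1) = th h k * x + th h k by ring, Real.cos_add, Real.cos_sub]
      ring

lemma cos_th_h (h k : ℕ) : Real.cos (th h k * h) = (-1)^k * Real.sin (th h k) := by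
  have hpos : (0:ℝ) < (h:ℝ)+1 := by positivity
  have : th h k * h = (π/2 - th h k) + k * π := by
    unfold th; field_simp; ring
  rw [this, Real.cos_add_nat_mul_pi, Real.cos_pi_div_two_sub]

lemma V_formula (n h : ℕ) (hn : 1 ≤ n) :
    (V n h : ℝ) / 2^n = (2/((h:ℝ)+1)) *
      ∑ k ∈ Finset.range (h+1), (-1:ℝ)^k * (Real.cos (th h k))^n * Real.sin (th h k) := by
  rcases Nat.eq_zero_or_pos h with h0 | h0
  · subst h0
    rw [V_zero_eq, cnt_formula n 0 0 (by simp)]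
    have : Real.cos (th 0 0) = 0 := by
      rw [show th 0 0 = π/2 by unfold th; simp]; exact Real.cos_pi_div_two
    simp [this, show n ≠ 0 by omega]
  · rw [V_eq_cnt n h h0]
    push_cast
    rw [cnt_formula n h h (by rw [abs_of_nonneg] <;> omega),
      cnt_formula n h (-h) (by rw [abs_neg, abs_of_nonneg] <;> omega)]
    push_cast
    have e : ∀ k, Real.cos (th h k * -(h:ℝ)) = (-1)^k * Real.sin (th h k) := by
      intro k
      rw [mul_neg, Real.cos_neg, cos_th_h]
    simp only [e, cos_th_h, mul_pow]
    rw [← two_mul, ← mul_assoc, mul_div_assoc, Finset.sum_div]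
    rw [show 2 * (1 / ((h:ℝ)+1)) = 2/((h:ℝ)+1) by ring]
    congr 1
    apply Finset.sum_congr rfl
    intro k _
    field_simp

/-- Folded form under the parity condition. -/
lemma V_folded (n h : ℕ) (hn : 1 ≤ n) (hp : h % 2 = n % 2) :
    (V n h : ℝ) / 2^n = (4/((h:ℝ)+1)) *
      ∑ k ∈ Finset.range (h+1), if 2*k < h then
        (-1:ℝ)^k * ((Real.cos (th h k))^n * Real.sin (th h k)) else 0 := by
  rw [V_formula n h hn]
  set t : ℕ → ℝ := fun k => (-1:ℝ)^k * ((Real.cos (th h k))^n * Real.sin (th h k)) with ht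
  have hpos : (0:ℝ) < (h:ℝ)+1 := by positivity
  have hrefl : ∀ k ≤ h, t (h - k) = t k := by
    intro k hk
    have e : th h (h-k) = π - th h k := by
      unfold th
      push_cast [hk]
      field_simp
      ring
    simp only [ht]
    rw [e, Real.cos_pi_sub, Real.sin_pi_sub, neg_pow]
    have : (-1:ℝ)^(h-k) * (-1)^n = (-1)^k := by
      rw [← pow_add]
      apply neg_one_pow_congr
      rw [Nat.even_iff, Nat.even_iff]
      omega
    rw [← this]; ring
  have hmid : ∀ k, 2*k = h → t k = 0 := by
    intro k hk
    have : Real.cos (th h k) = 0 := by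
      rw [show th h k = π/2 by unfold th; rw [← hk]; push_cast; field_simp]
      exact Real.cos_pi_div_two
    simp [ht, this, show n ≠ 0 by omega]
  have h1 : ∑ k ∈ Finset.range (h+1), (-1:ℝ)^k * (Real.cos (th h k))^n * Real.sin (th h k)
     = ∑ k ∈ Finset.range (h+1), ((if 2*k < h then t k else 0) + (if h < 2*k then t k else 0)) := by
    apply Finset.sum_congr rfl
    intro k _
    rw [mul_assoc]
    change t k = _
    rcases lt_trichotomy (2*k) h with h2 | h2 | h2
    · simp [h2, not_lt.mpr h2.le]
    · simp [h2, hmid k h2]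
    · simp [h2, not_lt.mpr h2.le]
  have h2 : ∑ k ∈ Finset.range (h+1), (if h < 2*k then t k else 0)
     = ∑ k ∈ Finset.range (h+1), (if 2*k < h then t k else 0) := by
    rw [← Finset.sum_flip]
    apply Finset.sum_congr rfl
    intro k hk
    have hk' : k ≤ h := by simpa [Nat.lt_succ_iff] using hk
    rw [hrefl k hk']
    have : (h < 2 * (h-k)) ↔ 2*k < h := by omega
    simp only [this]
  rw [h1, Finset.sum_add_distrib, h2]
  ring

lemma cnt_parity (n h : ℕ) : ∀ x : ℤ, cnt n h x ≠ 0 → x % 2 = (n:ℤ) % 2 ∧ |x| ≤ n := by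
  induction n with
  | zero => intro x hx; rw [cnt_base] at hx; split_ifs at hx with h1 <;> simp_all
  | succ n ih =>
    intro x hx
    by_cases h1 : |x| ≤ h
    · rw [cnt_succ n h x h1] at hx
      have : cnt n h (x-1) ≠ 0 ∨ cnt n h (x+1) ≠ 0 := by omega
      rcases this with h2 | h2
      · have := ih _ h2
        rw [abs_le] at *
        push_cast; omega
      · have := ih _ h2
        rw [abs_le] at *
        push_cast; omega
    · exact absurd (cnt_zero_of _ _ _ (by omega)) hx

lemma V_eq_zero_of (n h : ℕ) (hh : h % 2 ≠ n % 2 ∨ n < h) : V n h = 0 := by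
  by_contra hV
  rcases Nat.eq_zero_or_pos h with h0 | h0
  · subst h0
    rw [V_zero_eq] at hV
    have := cnt_parity n 0 _ hV
    omega
  · rw [V_eq_cnt n h h0] at hV
    have h1 : cnt n h h ≠ 0 ∨ cnt n h (-h) ≠ 0 := by omega
    rcases h1 with h1 | h1
    · have := cnt_parity n h _ h1
      rw [abs_le] at this; omega
    · have := cnt_parity n h _ h1
      rw [abs_le] at this; omega

lemma cos_le_exp_sq {x : ℝ} (h0 : 0 ≤ x) (h1 : x ≤ π/2) : Real.cos x ≤ Real.exp (-(x^2/2)) := by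
  have hd : ∀ y : ℝ, HasDerivAt (fun y => Real.exp (y^2/2) * Real.cos y)
      (Real.exp (y^2/2) * (y * Real.cos y - Real.sin y)) y := by
    intro y
    have e1 : HasDerivAt (fun y : ℝ => y^2/2) y y := by
      have := (hasDerivAt_pow 2 y).div_const 2
      simpa using this
    exact (e1.exp.fun_mul (Real.hasDerivAt_cos y)).congr_deriv (by ring)
  have hanti : AntitoneOn (fun y => Real.exp (y^2/2) * Real.cos y) (Set.Icc 0 (π/2)) := by
    apply antitoneOn_of_deriv_nonpos (convex_Icc _ _)
    · exact fun y _ => (hd y).continuousAt.continuousWithinAt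
    · exact fun y _ => (hd y).differentiableAt.differentiableWithinAt
    · intro y hy
      rw [interior_Icc] at hy
      rw [(hd y).deriv]
      have hc : 0 < Real.cos y := Real.cos_pos_of_mem_Ioo ⟨by linarith [hy.1, Real.pi_pos], hy.2⟩
      have ht := Real.le_tan hy.1.le hy.2
      rw [Real.tan_eq_sin_div_cos, le_div_iff₀ hc] at ht
      have := Real.exp_pos (y^2/2)
      nlinarith
  have := hanti ⟨le_rfl, by positivity⟩ ⟨h0, h1⟩ h0
  simp at this
  rw [Real.exp_neg, ← one_div, le_div_iff₀ (Real.exp_pos _)]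
  linarith

lemma exp_neg_le_quad {y : ℝ} (hy : 0 ≤ y) : Real.exp (-y) ≤ 1 - y + y^2/2 := by
  have h := Real.quadratic_le_exp_of_nonneg hy
  rw [Real.exp_neg, ← one_div, div_le_iff₀ (Real.exp_pos _)]
  nlinarith [sq_nonneg (1-y), sq_nonneg (y^2), mul_le_mul_of_nonneg_left h (show 0 ≤ 1 - y + y^2/2 by nlinarith [sq_nonneg (1-y)])]

lemma pow_sub_pow_le_aux {a b : ℝ} (hb : 0 ≤ b) (hab : b ≤ a) (n : ℕ) :
    a * (a^n - b^n) ≤ n * a^n * (a - b) := by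
  have ha : 0 ≤ a := hb.trans hab
  induction n with
  | zero => simp
  | succ n ih =>
    have h1 : a * (a^(n+1) - b^(n+1)) = a * a^n * (a-b) + b * (a * (a^n - b^n)) := by ring
    have h2 : b * (a * (a^n - b^n)) ≤ a * (a * (a^n - b^n)) := by
      apply mul_le_mul_of_nonneg_right hab
      exact mul_nonneg ha (sub_nonneg.2 (pow_le_pow_left₀ hb hab n))
    have h3 := mul_le_mul_of_nonneg_left ih ha
    rw [h1]; push_cast
    calc _ ≤ a * a^n * (a-b) + a * (n * a^n * (a-b)) := by linarith
      _ = _ := by ring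

lemma term_err (n : ℕ) {x : ℝ} (h0 : 0 ≤ x) (h1 : x ≤ π/2) :
    |Real.cos x ^ n * Real.sin x - x * Real.exp (-(n * x^2/2))|
      ≤ Real.exp (-(n * x^2/2)) * (x^3 + 2 * n * x^5) := by
  set a := Real.exp (-(x^2/2)) with ha
  set b := Real.cos x with hb
  have hb0 : 0 ≤ b := Real.cos_nonneg_of_mem_Icc ⟨by linarith [Real.pi_pos], h1⟩
  have hab : b ≤ a := cos_le_exp_sq h0 h1
  have hE : Real.exp (-(n * x^2/2)) = a^n := by
    rw [ha, ← Real.exp_nat_mul]; congr 1; ring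
  rw [hE]
  have hapos : 0 < a := Real.exp_pos _
  have hs1 := Real.sin_le h0
  have hs2 := Real.sin_ge_sub_cube h0
  have hs0 : 0 ≤ Real.sin x := Real.sin_nonneg_of_nonneg_of_le_pi h0 (by linarith [Real.pi_pos])
  have hd : a - b ≤ x^4/8 := by
    have e1 := exp_neg_le_quad (show 0 ≤ x^2/2 by positivity)
    have e2 := Real.one_sub_sq_div_two_le_cos (x := x)
    nlinarith
  have hainv : 1 ≤ 9 * a := by
    have : Real.exp (-2) ≤ a := by
      rw [ha]; apply Real.exp_le_exp.2
      have := Real.pi_lt_d2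
      nlinarith
    have e2 : 1/9 ≤ Real.exp (-2) := by
      rw [Real.exp_neg, ← one_div]
      apply one_div_le_one_div_of_le (Real.exp_pos _)
      have := Real.exp_one_lt_d9
      rw [show (2:ℝ) = 1 + 1 by norm_num, Real.exp_add]
      nlinarith [Real.exp_pos 1]
    linarith
  have hp : a^n - b^n ≤ 2 * n * a^n * x^4 := by
    have e1 := pow_sub_pow_le_aux hb0 hab n
    have e0 : 0 ≤ a^n - b^n := sub_nonneg.2 (pow_le_pow_left₀ hb0 hab n)
    have e2 : (n:ℝ) * a^n * (a-b) ≤ n * a^n * (x^4/8) := by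
      apply mul_le_mul_of_nonneg_left hd; positivity
    have e3 : a^n - b^n ≤ 9 * (a * (a^n - b^n)) := by nlinarith
    have e4 : 0 ≤ (n:ℝ) * a^n * x^4 := by positivity
    nlinarith
  have hbn : b^n ≤ a^n := pow_le_pow_left₀ hb0 hab n
  have hbn0 : 0 ≤ b^n := pow_nonneg hb0 n
  rw [abs_le]
  constructor
  · have e1 : b^n * (x - Real.sin x) ≤ a^n * (x^3) := by
      apply mul_le_mul hbn _ (by linarith) (by positivity)
      nlinarith [pow_nonneg h0 3]
    have e2 := mul_le_mul_of_nonneg_left hp h0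
    nlinarith
  · have e1 : b^n * Real.sin x ≤ a^n * x := mul_le_mul hbn hs1 hs0 (by positivity)
    have : 0 ≤ a^n * (x^3 + 2*n*x^5) := by positivity
    linarith

lemma gauss_poly (m : ℕ) {z : ℝ} (hz : 0 ≤ z) :
    (1+z)^m * Real.exp (-(z^2/2)) ≤ 5 * m.factorial := by
  have h1 := Real.pow_div_factorial_le_exp (1+z) (by linarith) m
  have hm : (0:ℝ) < m.factorial := by positivity
  rw [div_le_iff₀ hm] at h1
  have h2 : Real.exp (1+z) * Real.exp (-(z^2/2)) ≤ 5 := by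
    rw [← Real.exp_add]
    calc Real.exp (1 + z + -(z^2/2)) ≤ Real.exp (3/2) := by
          apply Real.exp_le_exp.2; nlinarith [sq_nonneg (z-1)]
      _ ≤ 5 := by
          have := Real.exp_one_lt_d9
          have h3 : Real.exp (3/2) ^ 2 = Real.exp 1 ^ 3 := by
            rw [← Real.exp_nat_mul, ← Real.exp_nat_mul]; norm_num
          have h4 : Real.exp 1 ^ 3 ≤ 2.72^3 := pow_le_pow_left₀ (Real.exp_pos _).le (by linarith) 3
          have h5 := Real.exp_pos (3/2)
          nlinarith
  calc (1+z)^m * Real.exp (-(z^2/2)) ≤ (Real.exp (1+z) * m.factorial) * Real.exp (-(z^2/2)) := by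
        gcongr
    _ = (Real.exp (1+z) * Real.exp (-(z^2/2))) * m.factorial := by ring
    _ ≤ _ := by gcongr

lemma err_bound {n : ℕ} (hn : 1 ≤ n) {x : ℝ} (h0 : 0 ≤ x) :
    Real.exp (-(n * x^2/2)) * (x^3 + 2 * n * x^5)
      ≤ 75600 / Real.sqrt n ^ 3 * (1 / (1 + Real.sqrt n * x)^2) := by
  have hn' : (0:ℝ) < n := by exact_mod_cast hn
  set s := Real.sqrt n with hs
  have hs0 : 0 < s := Real.sqrt_pos.2 hn'
  have hss : (n:ℝ) = s^2 := (Real.sq_sqrt hn'.le).symm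
  rw [hss]
  have hz : 0 ≤ s * x := by positivity
  have h := gauss_poly 7 hz
  rw [show s^2 * x^2/2 = (s*x)^2/2 by ring]
  rw [div_mul_div_comm, mul_one, le_div_iff₀ (by positivity)]
  set z := s * x with hzd
  set E := Real.exp (-(z^2/2)) with hE
  have hEpos : 0 < E := Real.exp_pos _
  calc E * (x^3 + 2 * s^2 * x^5) * (s^3 * (1+z)^2) = E * ((z^3 + 2 * z^5) * (1+z)^2) := by
        rw [hzd]; ring
    _ ≤ E * (3 * (1+z)^5 * (1+z)^2) := by
        gcongr
        have : z^3 ≤ (1+z)^5 := by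
          calc z^3 ≤ (1+z)^3 := by gcongr; linarith
            _ ≤ (1+z)^5 := pow_le_pow_right₀ (by linarith) (by norm_num)
        have : z^5 ≤ (1+z)^5 := by gcongr; linarith
        linarith
    _ = 3 * ((1+z)^7 * E) := by ring
    _ ≤ 3 * (5 * (Nat.factorial 7)) := by gcongr
    _ = 75600 := by norm_num [Nat.factorial]

lemma hasSum_tele {c : ℝ} (hc : 0 < c) :
    HasSum (fun k : ℕ => 1 / (1 + c * k) - 1 / (1 + c * (k+1))) 1 := by
  have hnn : ∀ k : ℕ, 0 ≤ 1 / (1 + c * (k:ℝ)) - 1 / (1 + c * (k+1)) := by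
    intro k
    rw [sub_nonneg]
    apply one_div_le_one_div_of_le (by positivity)
    nlinarith
  rw [hasSum_iff_tendsto_nat_of_nonneg hnn]
  have e : ∀ m : ℕ, ∑ k ∈ Finset.range m, (1 / (1 + c * (k:ℝ)) - 1 / (1 + c * (k+1)))
      = 1 - 1 / (1 + c * m) := by
    intro m
    have := Finset.sum_range_sub' (fun k : ℕ => 1 / (1 + c * (k:ℝ))) m
    push_cast at this
    rw [this]; simp
  simp only [e]
  have : Filter.Tendsto (fun m : ℕ => 1 / (1 + c * (m:ℝ))) Filter.atTop (nhds 0) := by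
    apply Filter.Tendsto.div_atTop tendsto_const_nhds
    apply Filter.tendsto_atTop_add_const_left
    exact (tendsto_natCast_atTop_atTop).const_mul_atTop hc
  simpa using this.const_sub 1

lemma th_pos (h k : ℕ) : 0 < th h k := by
  unfold th
  have := Real.pi_pos
  positivity

lemma V_approx (n h : ℕ) (hn : 1 ≤ n) (hp : h % 2 = n % 2) :
    |(V n h : ℝ) / 2^n - (4/((h:ℝ)+1)) *
      ∑' k : ℕ, (-1:ℝ)^k * (th h k * Real.exp (-(n * th h k ^2/2)))| ≤ 604800 / (n:ℝ)^2 := by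
  have hn' : (0:ℝ) < n := by exact_mod_cast hn
  set s := Real.sqrt n with hs
  have hs0 : 0 < s := Real.sqrt_pos.2 hn'
  have hss : (n:ℝ) = s^2 := (Real.sq_sqrt hn'.le).symm
  have hH : (0:ℝ) < (h:ℝ)+1 := by positivity
  set t : ℕ → ℝ := fun k => if 2*k < h then
        (-1:ℝ)^k * ((Real.cos (th h k))^n * Real.sin (th h k)) else 0 with ht
  set u : ℕ → ℝ := fun k => (-1:ℝ)^k * (th h k * Real.exp (-(n * th h k ^2/2))) with hu
  have htsupp : ∀ k ∉ Finset.range (h+1), t k = 0 := by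
    intro k hk
    simp only [Finset.mem_range, not_lt] at hk
    simp [ht, show ¬ 2*k < h by omega]
  have htS : Summable t := summable_of_ne_finset_zero htsupp
  rw [V_folded n h hn hp, show (∑ k ∈ Finset.range (h+1), if 2*k < h then
        (-1:ℝ)^k * ((Real.cos (th h k))^n * Real.sin (th h k)) else 0) = ∑' k, t k from
        (tsum_eq_sum (L := SummationFilter.unconditional ℕ) htsupp).symm]
  set c : ℝ := π * s / (2 * ((h:ℝ)+1)) with hc
  have hc0 : 0 < c := by rw [hc]; have := Real.pi_pos; positivity
  have hth : ∀ k : ℕ, s * th h k = c * (2*k+1) := by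
    intro k; rw [hc]; unfold th; field_simp
  have hbound : ∀ k, ‖t k - u k‖ ≤ 75600 / s^3 * (1/c) *
      (1 / (1 + c * k) - 1 / (1 + c * (k+1))) := by
    intro k
    have hθ := th_pos h k
    have h1 : ‖t k - u k‖ ≤ 75600 / s ^ 3 * (1 / (1 + s * th h k)^2) := by
      refine le_trans ?_ (err_bound hn hθ.le)
      rw [Real.norm_eq_abs]
      simp only [ht, hu]
      by_cases hk : 2*k < h
      · rw [if_pos hk, ← mul_sub, abs_mul, abs_pow, abs_neg, abs_one, one_pow, one_mul]
        apply term_err n hθ.le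
        unfold th
        have : (2:ℝ)*k < h := by exact_mod_cast hk
        rw [div_le_div_iff₀ (by positivity) (by norm_num)]
        nlinarith [Real.pi_pos]
      · rw [if_neg hk, zero_sub, abs_neg, abs_mul, abs_pow, abs_neg, abs_one, one_pow, one_mul,
          abs_of_pos (mul_pos hθ (Real.exp_pos _)), mul_comm]
        apply mul_le_mul_of_nonneg_left _ (Real.exp_pos _).le
        have hk' : (h:ℝ) ≤ 2*k := by exact_mod_cast not_lt.1 hk
        have h1 : 1 ≤ th h k := by
          unfold th
          rw [le_div_iff₀ (by positivity)]
          nlinarith [Real.pi_gt_three]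
        have : 0 ≤ 2 * (n:ℝ) * th h k^5 := by positivity
        nlinarith [mul_le_mul h1 h1 zero_le_one hθ.le]
    refine h1.trans ?_
    rw [mul_assoc]
    apply mul_le_mul_of_nonneg_left _ (by positivity)
    rw [hth k]
    have e : (1/c) * (1 / (1 + c * k) - 1 / (1 + c * (k+1))) = 1 / ((1 + c * k) * (1 + c * (k+1))) := by
      field_simp
      ring
    rw [e]
    apply one_div_le_one_div_of_le (by positivity)
    have : 0 ≤ c * k := by positivity
    nlinarith
  have hS := (hasSum_tele hc0).mul_left (75600 / s^3 * (1/c))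
  have hdS : Summable (fun k => t k - u k) := Summable.of_norm_bounded hS.summable hbound
  have huS : Summable u := by
    have := htS.sub hdS
    simpa using this
  have hle := tsum_of_norm_bounded hS hbound
  rw [htS.tsum_sub huS, Real.norm_eq_abs, mul_one] at hle
  rw [← mul_sub, abs_mul, abs_of_pos (by positivity : (0:ℝ) < 4/((h:ℝ)+1))]
  calc _ ≤ 4/((h:ℝ)+1) * (75600 / s^3 * (1/c)) := by gcongr
    _ = 604800 / (n:ℝ)^2 / π := by
        rw [hc, hss]; have := Real.pi_pos.ne'; field_simp; norm_num
    _ ≤ 604800 / (n:ℝ)^2 := by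
        apply div_le_self (by positivity); linarith [Real.pi_gt_three]

/-- The theta series. -/
noncomputable def Gt (a : ℝ) : ℝ :=
  ∑' k : ℕ, (-1 : ℝ) ^ k * (2 * (k : ℝ) + 1) * Real.exp (-((2 * (k : ℝ) + 1) ^ 2 * a))

lemma hasSum_odd_side {x : ℝ} (hx : 0 < x) :
    HasSum (fun k : ℕ => 1/4 * ((-1 : ℝ) ^ k * (2 * (k : ℝ) + 1) *
      Real.exp (-((2 * (k : ℝ) + 1) ^ 2 * (π * x / 16)))))
      (HurwitzZeta.oddKernel ((1/4 : ℝ) : UnitAddCircle) x) := by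
  have h := HurwitzZeta.hasSum_int_oddKernel (1/4) hx
  rw [← Equiv.intEquivNat.symm.hasSum_iff] at h
  refine h.congr_fun fun k => ?_
  obtain ⟨n, rfl⟩ := Equiv.intEquivNat.surjective k
  simp only [Function.comp, Equiv.symm_apply_apply]
  rcases n with m | m
  · have : Equiv.intEquivNat (Int.ofNat m) = 2 * m := rfl
    rw [this]
    have e : (-1:ℝ)^(2*m) = 1 := by simp
    rw [e]
    push_cast
    have e2 : -((2 * (2 * (m:ℝ)) + 1)^2 * (π * x / 16)) = -π * ((m:ℝ) + 1/4)^2 * x := by ring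
    rw [e2]
    simp
    ring
  · have : Equiv.intEquivNat (Int.negSucc m) = 2 * m + 1 := rfl
    rw [this]
    have e : (-1:ℝ)^(2*m+1) = -1 := by rw [pow_succ]; simp
    rw [e]
    push_cast
    have e2 : -((2 * (2 * (m:ℝ) + 1) + 1)^2 * (π * x / 16)) = -π * (-((m:ℝ)+1) + 1/4)^2 * x := by ring
    rw [e2]
    ring

lemma hasSum_sin_side {t : ℝ} (ht : 0 < t) :
    HasSum (fun k : ℕ => 2 * ((-1 : ℝ) ^ k * (2 * (k : ℝ) + 1) *
      Real.exp (-((2 * (k : ℝ) + 1) ^ 2 * (π * t)))))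
      (HurwitzZeta.sinKernel ((1/4 : ℝ) : UnitAddCircle) t) := by
  have h := HurwitzZeta.hasSum_nat_sinKernel (1/4) ht
  have hinj : Function.Injective (fun k : ℕ => 2 * k + 1) := fun a b hab => by
    simp only at hab; omega
  rw [← hinj.hasSum_iff] at h
  · refine h.congr_fun fun k => ?_
    simp only [Function.comp]
    have e : Real.sin (2 * π * (1/4) * ((2*k+1 : ℕ) : ℝ)) = (-1)^k := by
      rw [show 2 * π * (1/4) * ((2*k+1 : ℕ) : ℝ) = k * π + π/2 by push_cast; ring,
        Real.sin_add_pi_div_two, Real.cos_nat_mul_pi]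
    rw [e]
    push_cast
    rw [show -((2 * (k:ℝ) + 1)^2 * (π * t)) = -π * (2 * (k:ℝ) + 1)^2 * t by ring]
    ring
  · intro n hn
    have hev : Even n := by
      by_contra hodd
      rw [Nat.not_even_iff_odd] at hodd
      obtain ⟨m, hm⟩ := hodd
      exact hn ⟨m, hm.symm⟩
    obtain ⟨m, hm⟩ := hev
    have e : Real.sin (2 * π * (1/4) * (n : ℝ)) = 0 := by
      rw [hm, show 2 * π * (1/4) * ((m + m : ℕ) : ℝ) = m * π by push_cast; ring]
      exact Real.sin_nat_mul_pi m
    rw [e]; simp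

lemma Gt_summable {a : ℝ} (ha : 0 < a) : Summable (fun k : ℕ => (-1 : ℝ) ^ k * (2 * (k : ℝ) + 1) *
      Real.exp (-((2 * (k : ℝ) + 1) ^ 2 * a))) := by
  have h := (hasSum_sin_side (t := a/π) (div_pos ha Real.pi_pos)).summable
  have e : π * (a/π) = a := by have := Real.pi_pos.ne'; field_simp
  rw [e] at h
  have h2 := h.mul_left (1/2)
  refine h2.congr fun k => ?_
  ring

lemma phi_eq_Gt (η : ℝ) : phiDensity η = 4 * η / π * Gt (η^2/2) := by
  unfold phiDensity Gt
  simp only [mul_div_assoc]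

lemma Gt_fe {x : ℝ} (hx : 0 < x) :
    1/4 * Gt (π * x / 16) = 1 / x^(3/2 : ℝ) * (2 * Gt (π / x)) := by
  have h1 := (hasSum_odd_side hx).tsum_eq
  have h2 := (hasSum_sin_side (one_div_pos.2 hx)).tsum_eq
  rw [HurwitzZeta.oddKernel_functional_equation, ← h2, tsum_mul_left, tsum_mul_left] at h1
  rw [show π * (1/x) = π / x by ring] at h1
  exact h1

lemma phi_dual {η : ℝ} (hη : 0 < η) :
    phiDensity η = Real.sqrt (2 * π) / η^2 * Gt (π^2 / (8 * η^2)) := by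
  have hpi := Real.pi_pos
  have hx : 0 < 8 * η^2 / π := by positivity
  have h := Gt_fe hx
  rw [show π * (8 * η^2 / π) / 16 = η^2/2 by field_simp; norm_num,
    show π / (8 * η^2 / π) = π^2 / (8 * η^2) by field_simp] at h
  have hG : Gt (η^2/2) = 8 / (8 * η^2 / π)^(3/2:ℝ) * Gt (π^2 / (8 * η^2)) := by
    have : Gt (η^2/2) = 4 * (1/4 * Gt (η^2/2)) := by ring
    rw [this, h]; ring
  rw [phi_eq_Gt, hG, ← mul_assoc]
  congr 1
  rw [show (3/2:ℝ) = 1 + 1/2 by norm_num, Real.rpow_add hx, Real.rpow_one, ← Real.sqrt_eq_rpow]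
  have hs : Real.sqrt (8 * η^2 / π) = 4 * η / Real.sqrt (2 * π) := by
    rw [Real.sqrt_eq_iff_mul_self_eq hx.le (by positivity), div_mul_div_comm,
      Real.mul_self_sqrt (by positivity)]
    field_simp
    norm_num
  rw [hs]
  have hq : Real.sqrt (2*π) ≠ 0 := by positivity
  field_simp

lemma V_phi (n h : ℕ) (hn : 1 ≤ n) (hp : h % 2 = n % 2) :
    |(V n h : ℝ) / 2^n - Real.sqrt (2*π) / n * phiDensity (((h:ℝ)+1) / Real.sqrt n)|
      ≤ 604800 / (n:ℝ)^2 := by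
  have h1 := V_approx n h hn hp
  have hn' : (0:ℝ) < n := by exact_mod_cast hn
  have hH : (0:ℝ) < (h:ℝ)+1 := by positivity
  have hpi := Real.pi_pos
  have e : (4/((h:ℝ)+1)) * ∑' k : ℕ, (-1:ℝ)^k * (th h k * Real.exp (-(n * th h k ^2/2)))
     = Real.sqrt (2*π) / n * phiDensity (((h:ℝ)+1) / Real.sqrt n) := by
    rw [phi_dual (by positivity)]
    have e1 : ∑' k : ℕ, (-1:ℝ)^k * (th h k * Real.exp (-(n * th h k ^2/2)))
       = π / (2 * ((h:ℝ)+1)) * Gt (π^2 / (8 * (((h:ℝ)+1) / Real.sqrt n)^2)) := by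
      unfold Gt
      rw [← tsum_mul_left]
      apply tsum_congr
      intro k
      rw [div_pow, Real.sq_sqrt hn'.le]
      have e2 : (2 * (k:ℝ) + 1)^2 * (π^2 / (8 * (((h:ℝ)+1)^2 / n))) = n * th h k ^2/2 := by
        unfold th; field_simp; norm_num
      rw [e2]
      unfold th
      ring
    rw [e1, ← mul_assoc, ← mul_assoc]
    congr 1
    rw [div_pow, Real.sq_sqrt hn'.le, div_mul_div_comm, div_mul_div_comm,
      Real.mul_self_sqrt (by positivity)]
    field_simp
    norm_num
  rwa [e] at h1

lemma Gt_lower {a : ℝ} (ha : 1/2 ≤ a) : Real.exp (-a) / 2 ≤ Gt a := by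
  have hs := (Gt_summable (show 0 < a by linarith)).hasSum.tendsto_sum_nat
  have e : ∀ k : ℕ, (-1 : ℝ) ^ k * (2 * (k : ℝ) + 1) * Real.exp (-((2 * (k : ℝ) + 1) ^ 2 * a))
     = (-1 : ℝ) ^ k * ((2 * (k : ℝ) + 1) * Real.exp (-((2 * (k : ℝ) + 1) ^ 2 * a))) :=
    fun k => by ring
  have he4 : 5 ≤ Real.exp 4 := by
    have := Real.add_one_le_exp (4:ℝ); linarith
  have hanti : Antitone (fun k : ℕ => (2 * (k : ℝ) + 1) * Real.exp (-((2 * (k : ℝ) + 1) ^ 2 * a))) := by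
    apply antitone_nat_of_succ_le
    intro k
    push_cast
    have e1 : Real.exp (-((2 * (k : ℝ) + 1) ^ 2 * a)) =
        Real.exp (-((2 * ((k : ℝ)+1) + 1) ^ 2 * a)) * Real.exp (8 * a * (k+1)) := by
      rw [← Real.exp_add]; congr 1; ring
    rw [e1]
    have e2 : 5 ≤ Real.exp (8 * a * (k+1)) := by
      refine he4.trans (Real.exp_le_exp.2 ?_)
      have : (0:ℝ) ≤ k := by positivity
      nlinarith
    have e3 := Real.exp_pos (-((2 * ((k : ℝ)+1) + 1) ^ 2 * a))
    have : (0:ℝ) ≤ k := by positivity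
    calc (2 * ((k:ℝ)+1) + 1) * Real.exp (-((2 * ((k : ℝ)+1) + 1) ^ 2 * a))
        ≤ ((2 * (k:ℝ) + 1) * 5) * Real.exp (-((2 * ((k : ℝ)+1) + 1) ^ 2 * a)) := by
          gcongr; linarith
      _ ≤ ((2 * (k:ℝ) + 1) * Real.exp (8 * a * (k+1))) * Real.exp (-((2 * ((k : ℝ)+1) + 1) ^ 2 * a)) := by
          gcongr
      _ = _ := by ring
  have hs' : Filter.Tendsto (fun n : ℕ => ∑ k ∈ Finset.range n, (-1 : ℝ) ^ k *
      ((2 * (k : ℝ) + 1) * Real.exp (-((2 * (k : ℝ) + 1) ^ 2 * a)))) Filter.atTop (nhds (Gt a)) := by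
    simp only [← e]; exact hs
  have h := hanti.alternating_series_le_tendsto hs' 1
  simp [Finset.sum_range_succ] at h
  have e1 : Real.exp (-((2+1)^2 * a)) = Real.exp (-a) * Real.exp (-(8*a)) := by
    rw [← Real.exp_add]; congr 1; ring
  rw [e1] at h
  have e2 : Real.exp (-(8*a)) ≤ 1/6 := by
    have : Real.exp (-(8*a)) ≤ Real.exp (-4) := Real.exp_le_exp.2 (by linarith)
    refine this.trans ?_
    rw [Real.exp_neg, ← one_div]
    apply one_div_le_one_div_of_le (by norm_num)
    have := Real.quadratic_le_exp_of_nonneg (show (0:ℝ) ≤ 4 by norm_num); linarith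
  have := Real.exp_pos (-a)
  nlinarith

lemma summable_odd_sq : Summable (fun k : ℕ => 1 / (2 * (k:ℝ) + 1)^2) := by
  refine Summable.of_nonneg_of_le (fun k => by positivity) (fun k => ?_)
    ((hasSum_tele one_pos).summable.mul_left 2)
  have e : 2 * (1 / (1 + 1 * (k:ℝ)) - 1 / (1 + 1 * ((k:ℝ)+1))) = 2 / ((1 + k) * (2 + k)) := by
    field_simp; ring
  rw [e, div_le_div_iff₀ (by positivity) (by positivity)]
  have : (0:ℝ) ≤ k := by positivity
  nlinarith

/-- The constant `Σ 1/(2k+1)^2`. -/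
noncomputable def S2 : ℝ := ∑' k : ℕ, 1 / (2 * (k:ℝ) + 1)^2

lemma S2_nonneg : 0 ≤ S2 := tsum_nonneg fun k => by positivity

lemma tsum_lip {f f' : ℕ → ℝ → ℝ} {x y C : ℝ} (hxy : x ≤ y)
    (hd : ∀ k, ∀ t ∈ Set.Icc x y, HasDerivAt (f k) (f' k t) t)
    (hb : ∀ k, ∀ t ∈ Set.Icc x y, |f' k t| ≤ C * (1 / (2 * (k:ℝ) + 1)^2))
    (hx : Summable (fun k => f k x)) (hy : Summable (fun k => f k y)) :
    |(∑' k, f k y) - ∑' k, f k x| ≤ C * S2 * (y - x) := by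
  rw [← hy.tsum_sub hx, ← Real.norm_eq_abs]
  have hS := (summable_odd_sq.hasSum.mul_left C).mul_right (y - x)
  apply tsum_of_norm_bounded hS
  intro k
  have := Convex.norm_image_sub_le_of_norm_hasDerivWithin_le (f := f k) (f' := f' k)
    (fun t ht => (hd k t ht).hasDerivWithinAt) (fun t ht => by
      rw [Real.norm_eq_abs]; exact hb k t ht) (convex_Icc x y)
    (Set.left_mem_Icc.2 hxy) (Set.right_mem_Icc.2 hxy)
  rwa [Real.norm_of_nonneg (sub_nonneg.2 hxy)] at this

lemma gauss5 {z : ℝ} (hz : 0 ≤ z) : (1+z)^5 * Real.exp (-(z^2/2)) ≤ 600 := by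
  have := gauss_poly 5 hz
  norm_num [Nat.factorial] at this
  exact this

lemma phi_lip_direct {x y : ℝ} (hx : 0 < x) (hxy : x ≤ y) :
    |phiDensity y - phiDensity x| ≤ 1200 * S2 / x^3 * (y - x) := by
  have hy : 0 < y := hx.trans_le hxy
  have hpi := Real.pi_pos
  have rep : ∀ t : ℝ, phiDensity t = 4/π * ∑' k : ℕ, (-1:ℝ)^k *
      (t * (2 * (k:ℝ) + 1) * Real.exp (-((2 * (k:ℝ) + 1)^2 * t^2/2))) := by
    intro t
    unfold phiDensity
    rw [← tsum_mul_left, ← tsum_mul_left]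
    apply tsum_congr; intro k; ring
  have hsum : ∀ t : ℝ, 0 < t → Summable (fun k : ℕ => (-1:ℝ)^k *
      (t * (2 * (k:ℝ) + 1) * Real.exp (-((2 * (k:ℝ) + 1)^2 * t^2/2)))) := by
    intro t ht
    refine ((Gt_summable (show 0 < t^2/2 by positivity)).mul_left t).congr fun k => ?_
    rw [mul_div_assoc]; ring
  have key := tsum_lip (f := fun k t => (-1:ℝ)^k *
      (t * (2 * (k:ℝ) + 1) * Real.exp (-((2 * (k:ℝ) + 1)^2 * t^2/2))))
    (f' := fun k t => (-1:ℝ)^k * ((2 * (k:ℝ) + 1) * (1 - (2 * (k:ℝ) + 1)^2 * t^2) *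
      Real.exp (-((2 * (k:ℝ) + 1)^2 * t^2/2)))) (C := 600 / x^3) hxy ?_ ?_ (hsum x hx) (hsum y hy)
  · rw [rep, rep, ← mul_sub, abs_mul, abs_of_pos (by positivity)]
    have h4 : 4/π ≤ 2 := by rw [div_le_iff₀ hpi]; linarith [Real.pi_gt_three]
    calc _ ≤ 2 * (600 / x^3 * S2 * (y-x)) := by gcongr
      _ = _ := by ring
  · intro k t _
    apply HasDerivAt.const_mul
    have e1 : HasDerivAt (fun t : ℝ => -((2 * (k:ℝ) + 1)^2 * t^2/2)) (-((2 * (k:ℝ) + 1)^2 * t)) t := by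
      refine ((((hasDerivAt_pow 2 t).const_mul ((2 * (k:ℝ) + 1)^2)).div_const 2).fun_neg).congr_deriv ?_
      norm_num; ring
    have e2 : HasDerivAt (fun t : ℝ => t * (2 * (k:ℝ) + 1)) (2 * (k:ℝ) + 1) t := by
      simpa using (hasDerivAt_id t).mul_const (2 * (k:ℝ) + 1)
    exact (e2.fun_mul e1.exp).congr_deriv (by ring)
  · intro k t ht
    have ht0 : 0 < t := hx.trans_le ht.1
    set w : ℝ := 2 * (k:ℝ) + 1 with hw
    have hw0 : 0 < w := by positivity
    have hz : 0 ≤ w * t := by positivity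
    have h5 := gauss5 hz
    have hE := Real.exp_pos (-((w*t)^2/2))
    rw [abs_mul, abs_pow, abs_neg, abs_one, one_pow, one_mul, abs_mul, abs_mul, abs_of_pos hw0,
      Real.abs_exp, show w^2 * t^2 = (w*t)^2 by ring]
    have e1 : |1 - (w*t)^2| ≤ (1 + w*t)^2 := by
      rw [abs_le]; constructor <;> nlinarith
    have e2 : (w*t)^3 ≤ (1+w*t)^3 := by gcongr; linarith
    have e3 : (w*t)^3 * ((1 + w*t)^2 * Real.exp (-((w*t)^2/2))) ≤ 600 := by
      calc _ ≤ (1+w*t)^3 * ((1 + w*t)^2 * Real.exp (-((w*t)^2/2))) := by gcongr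
        _ = (1+w*t)^5 * Real.exp (-((w*t)^2/2)) := by ring
        _ ≤ 600 := h5
    have e4 : (1 + w*t)^2 * Real.exp (-((w*t)^2/2)) ≤ 600 / (w*t)^3 := by
      rw [le_div_iff₀ (by positivity)]; linarith
    calc w * |1 - (w*t)^2| * Real.exp (-((w*t)^2/2))
        ≤ w * (1 + w*t)^2 * Real.exp (-((w*t)^2/2)) := by gcongr
      _ = w * ((1 + w*t)^2 * Real.exp (-((w*t)^2/2))) := by ring
      _ ≤ w * (600 / (w*t)^3) := by gcongr
      _ = 600 / t^3 * (1/w^2) := by field_simp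
      _ ≤ 600 / x^3 * (1/w^2) := by gcongr; exact ht.1

lemma phi_lip_dual {x y : ℝ} (hx : 0 < x) (hxy : x ≤ y) :
    |phiDensity y - phiDensity x| ≤ 6000 * S2 * (y - x) := by
  have hy : 0 < y := hx.trans_le hxy
  have hpi := Real.pi_pos
  have rep : ∀ t : ℝ, 0 < t → phiDensity t = Real.sqrt (2*π) * ∑' k : ℕ, (-1:ℝ)^k *
      ((2 * (k:ℝ) + 1) * (t^2)⁻¹ * Real.exp (-((2 * (k:ℝ) + 1)^2 * π^2/8) * (t^2)⁻¹)) := by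
    intro t ht
    rw [phi_dual ht]
    unfold Gt
    rw [← tsum_mul_left, ← tsum_mul_left]
    apply tsum_congr; intro k
    rw [show -((2 * (k:ℝ) + 1)^2 * (π^2 / (8 * t^2))) = -((2 * (k:ℝ) + 1)^2 * π^2/8) * (t^2)⁻¹ by
      field_simp]
    ring
  have hsum : ∀ t : ℝ, 0 < t → Summable (fun k : ℕ => (-1:ℝ)^k *
      ((2 * (k:ℝ) + 1) * (t^2)⁻¹ * Real.exp (-((2 * (k:ℝ) + 1)^2 * π^2/8) * (t^2)⁻¹))) := by
    intro t ht
    refine ((Gt_summable (show 0 < π^2 / (8 * t^2) by positivity)).mul_left (t^2)⁻¹).congr fun k => ?_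
    rw [show -((2 * (k:ℝ) + 1)^2 * (π^2 / (8 * t^2))) = -((2 * (k:ℝ) + 1)^2 * π^2/8) * (t^2)⁻¹ by
      field_simp]
    ring
  have key := tsum_lip (f := fun k t => (-1:ℝ)^k *
      ((2 * (k:ℝ) + 1) * (t^2)⁻¹ * Real.exp (-((2 * (k:ℝ) + 1)^2 * π^2/8) * (t^2)⁻¹)))
    (f' := fun k t => (-1:ℝ)^k * ((2 * (k:ℝ) + 1) * (t^3)⁻¹ *
      (-2 + (π * (2 * (k:ℝ) + 1) / (2*t))^2) *
      Real.exp (-((2 * (k:ℝ) + 1)^2 * π^2/8) * (t^2)⁻¹))) (C := 1200) hxy ?_ ?_ (hsum x hx) (hsum y hy)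
  · rw [rep x hx, rep y hy, ← mul_sub, abs_mul, abs_of_pos (by positivity)]
    have h4 : Real.sqrt (2*π) ≤ 5 := by
      rw [Real.sqrt_le_left (by norm_num)]; linarith [Real.pi_lt_four]
    calc _ ≤ 5 * (1200 * S2 * (y-x)) := by gcongr
      _ = _ := by ring
  · intro k t ht
    have ht0 : 0 < t := hx.trans_le ht.1
    apply HasDerivAt.const_mul
    have e0 : HasDerivAt (fun t : ℝ => (t^2)⁻¹) (-2 * (t^3)⁻¹) t := by
      refine ((hasDerivAt_pow 2 t).fun_inv (by positivity)).congr_deriv ?_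
      field_simp; norm_num; ring
    have e1 := e0.const_mul (-((2 * (k:ℝ) + 1)^2 * π^2/8))
    have e2 := e0.const_mul (2 * (k:ℝ) + 1)
    refine (e2.fun_mul e1.exp).congr_deriv ?_
    field_simp
    ring
  · intro k t ht
    have ht0 : 0 < t := hx.trans_le ht.1
    set w : ℝ := 2 * (k:ℝ) + 1 with hw
    have hw0 : 0 < w := by positivity
    set z : ℝ := π * w / (2*t) with hzd
    have hz : 0 ≤ z := by positivity
    have h5 := gauss5 hz
    have hE := Real.exp_pos (-(z^2/2))
    rw [show -(w^2 * π^2/8) * (t^2)⁻¹ = -(z^2/2) by rw [hzd]; field_simp; norm_num]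
    rw [abs_mul, abs_pow, abs_neg, abs_one, one_pow, one_mul, abs_mul, abs_mul, Real.abs_exp,
      abs_of_pos (by positivity : 0 < w * (t^3)⁻¹)]
    have e1 : |-2 + z^2| ≤ 2 * (1 + z)^2 := by
      rw [abs_le]; constructor <;> nlinarith
    have e2 : w * (t^3)⁻¹ ≤ z^3 * (1/w^2) := by
      have : z^3 * (1/w^2) = (π/2)^3 * (w * (t^3)⁻¹) := by rw [hzd]; field_simp
      rw [this]
      have h1 : 1 ≤ (π/2)^3 := one_le_pow₀ (by linarith [Real.pi_gt_three])
      have h2 : 0 < w * (t^3)⁻¹ := by positivity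
      nlinarith
    calc w * (t^3)⁻¹ * |-2 + z^2| * Real.exp (-(z^2/2))
        ≤ (z^3 * (1/w^2)) * (2 * (1 + z)^2) * Real.exp (-(z^2/2)) := by gcongr
      _ ≤ ((1+z)^3 * (1/w^2)) * (2 * (1 + z)^2) * Real.exp (-(z^2/2)) := by gcongr; linarith
      _ = 2 * ((1+z)^5 * Real.exp (-(z^2/2))) * (1/w^2) := by ring
      _ ≤ 2 * 600 * (1/w^2) := by gcongr
      _ = 1200 * (1/w^2) := by ring

lemma phi_lip : ∃ L : ℝ, 0 < L ∧ ∀ x y : ℝ, 0 < x → x ≤ y →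
    |phiDensity y - phiDensity x| ≤ L / (1+x)^2 * (y - x) := by
  refine ⟨24000 * S2 + 1, by have := S2_nonneg; positivity, fun x y hx hxy => ?_⟩
  have hS := S2_nonneg
  have hyx : 0 ≤ y - x := sub_nonneg.2 hxy
  rcases le_total x 1 with h1 | h1
  · refine (phi_lip_dual hx hxy).trans ?_
    gcongr
    rw [le_div_iff₀ (by positivity)]
    nlinarith [mul_nonneg hS (show 0 ≤ 4 - (1+x)^2 by nlinarith)]
  · refine (phi_lip_direct hx hxy).trans ?_
    apply mul_le_mul_of_nonneg_right _ hyx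
    rw [div_le_div_iff₀ (by positivity) (by positivity)]
    have : (1+x)^2 ≤ 4 * x^3 := by nlinarith [mul_nonneg (sub_nonneg.2 h1) (sub_nonneg.2 h1), mul_nonneg (mul_nonneg (sub_nonneg.2 h1) (sub_nonneg.2 h1)) hx.le]
    nlinarith [mul_le_mul_of_nonneg_left this hS, pow_pos hx 3, mul_nonneg hS (pow_pos hx 3).le]

/-- The antiderivative of the density. -/
noncomputable def PhiA (x : ℝ) : ℝ :=
  -(4/π) * ∑' k : ℕ, (-1:ℝ)^k * (1/(2 * (k:ℝ) + 1) * Real.exp (-((2 * (k:ℝ) + 1)^2 * x^2/2)))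

lemma PhiA_summable {x : ℝ} (hx : 0 < x) : Summable (fun k : ℕ =>
    (-1:ℝ)^k * (1/(2 * (k:ℝ) + 1) * Real.exp (-((2 * (k:ℝ) + 1)^2 * x^2/2)))) := by
  have h := (Gt_summable (show 0 < x^2/2 by positivity)).norm
  refine Summable.of_norm_bounded h fun k => ?_
  simp only [norm_mul, norm_pow, norm_neg, norm_one, one_pow, one_mul, Real.norm_eq_abs, Real.abs_exp]
  rw [mul_div_assoc, abs_of_pos (by positivity), abs_of_pos (by positivity)]
  apply mul_le_mul_of_nonneg_right _ (Real.exp_pos _).le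
  have : (0:ℝ) ≤ k := by positivity
  rw [div_le_iff₀ (by positivity)]
  nlinarith

lemma PhiA_bound {x : ℝ} (hx : 0 < x) : |PhiA x| ≤ 2 * (600 * S2) / x := by
  have hpi := Real.pi_pos
  have hb : ∀ k : ℕ, ‖(-1:ℝ)^k * (1/(2 * (k:ℝ) + 1) * Real.exp (-((2 * (k:ℝ) + 1)^2 * x^2/2)))‖
      ≤ 600 / x * (1 / (2 * (k:ℝ) + 1)^2) := by
    intro k
    set w : ℝ := 2 * (k:ℝ) + 1 with hw
    have hw0 : 0 < w := by positivity
    have h5 := gauss5 (show 0 ≤ w * x by positivity)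
    simp only [norm_mul, norm_pow, norm_neg, norm_one, one_pow, one_mul, Real.norm_eq_abs, Real.abs_exp]
    rw [abs_of_pos (by positivity), show w^2 * x^2 = (w*x)^2 by ring]
    have e0 : w * x ≤ (1+w*x)^5 := by
      calc w * x ≤ (1 + w*x)^1 := by linarith
        _ ≤ (1+w*x)^5 := pow_le_pow_right₀ (by have : 0 < w * x := by positivity
                                               linarith) (by norm_num)
    have e1 : Real.exp (-((w*x)^2/2)) ≤ 600 / (w*x) := by
      rw [le_div_iff₀ (by positivity), mul_comm]
      refine le_trans ?_ h5
      gcongr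
    calc 1/w * Real.exp (-((w*x)^2/2)) ≤ 1/w * (600/(w*x)) := by gcongr
      _ = _ := by field_simp
  have h := tsum_of_norm_bounded (summable_odd_sq.hasSum.mul_left (600/x)) hb
  unfold PhiA
  rw [abs_mul, abs_neg, abs_of_pos (by positivity : 0 < 4/π)]
  have h4 : 4/π ≤ 2 := by rw [div_le_iff₀ hpi]; linarith [Real.pi_gt_three]
  rw [Real.norm_eq_abs] at h
  calc _ ≤ 2 * (600/x * S2) := by gcongr; exact h
    _ = _ := by ring

lemma PhiA_deriv {x : ℝ} (hx : 0 < x) : HasDerivAt PhiA (phiDensity x) x := by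
  have hpi := Real.pi_pos
  have hmem : x ∈ Set.Ioi (x/2) := by simp; linarith
  have key := hasDerivAt_tsum_of_isPreconnected (t := Set.Ioi (x/2)) (y₀ := x) (y := x)
    (g := fun k t => (-1:ℝ)^k * (1/(2 * (k:ℝ) + 1) * Real.exp (-((2 * (k:ℝ) + 1)^2 * t^2/2))))
    (g' := fun k t => (-1:ℝ)^k * (-(2 * (k:ℝ) + 1) * t * Real.exp (-((2 * (k:ℝ) + 1)^2 * t^2/2))))
    (u := fun k : ℕ => 600 / (x/2)^2 * (1 / (2 * (k:ℝ) + 1)^2))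
    (summable_odd_sq.mul_left _) isOpen_Ioi isPreconnected_Ioi ?_ ?_ hmem (PhiA_summable hx) hmem
  · refine (key.const_mul (-(4/π))).congr_deriv ?_
    unfold phiDensity
    rw [← tsum_mul_left, ← tsum_mul_left]
    apply tsum_congr; intro k; ring
  · intro k t _
    apply HasDerivAt.const_mul
    have e1 : HasDerivAt (fun t : ℝ => -((2 * (k:ℝ) + 1)^2 * t^2/2)) (-((2 * (k:ℝ) + 1)^2 * t)) t := by
      refine ((((hasDerivAt_pow 2 t).const_mul ((2 * (k:ℝ) + 1)^2)).div_const 2).fun_neg).congr_deriv ?_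
      norm_num; ring
    refine (e1.exp.const_mul (1/(2 * (k:ℝ) + 1))).congr_deriv ?_
    field_simp
  · intro k t ht
    have ht1 : x/2 < t := ht
    have ht0 : 0 < t := by linarith
    set w : ℝ := 2 * (k:ℝ) + 1 with hw
    have hw0 : 0 < w := by positivity
    have hz : 0 ≤ w * t := by positivity
    have h5 := gauss5 hz
    simp only [norm_mul, norm_pow, norm_neg, norm_one, one_pow, one_mul, Real.norm_eq_abs, Real.abs_exp]
    rw [abs_of_pos hw0, abs_of_pos ht0, show w^2 * t^2 = (w*t)^2 by ring]
    have e0 : (w * t)^3 ≤ (1+w*t)^5 := by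
      calc (w * t)^3 ≤ (1 + w*t)^3 := by gcongr; linarith
        _ ≤ (1+w*t)^5 := pow_le_pow_right₀ (by linarith) (by norm_num)
    have e1 : w * t * Real.exp (-((w*t)^2/2)) ≤ 600 / (w*t)^2 := by
      rw [le_div_iff₀ (by positivity)]
      calc _ = (w*t)^3 * Real.exp (-((w*t)^2/2)) := by ring
        _ ≤ (1+w*t)^5 * Real.exp (-((w*t)^2/2)) := by gcongr
        _ ≤ 600 := h5
    refine e1.trans ?_
    calc 600 / (w*t)^2 = 600 / t^2 * (1/w^2) := by field_simp
      _ ≤ _ := by gcongr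

lemma PhiA_zero : Filter.Tendsto PhiA (nhdsWithin 0 (Set.Ioi 0)) (nhds (-1)) := by
  have hpi := Real.pi_pos
  set F : ℝ → ℝ := fun x => ∑' k : ℕ, (-1:ℝ)^k *
    (1/(2 * (k:ℝ) + 1) * Real.exp (-((2 * (k:ℝ) + 1)^2 * x^2/2))) with hF
  set P : ℕ → ℝ → ℝ := fun m x => ∑ k ∈ Finset.range m, (-1:ℝ)^k *
    (1/(2 * (k:ℝ) + 1) * Real.exp (-((2 * (k:ℝ) + 1)^2 * x^2/2))) with hP
  have hPc : ∀ m, Continuous (P m) := by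
    intro m; simp only [hP]; fun_prop
  have hanti : ∀ x : ℝ, Antitone (fun k : ℕ =>
      (1/(2 * (k:ℝ) + 1) * Real.exp (-((2 * (k:ℝ) + 1)^2 * x^2/2)))) := by
    intro x a b hab
    have : (a:ℝ) ≤ b := by exact_mod_cast hab
    simp only
    gcongr
  have hlow : ∀ x : ℝ, 0 < x → ∀ m, P (2*m) x ≤ F x := fun x hx m =>
    (hanti x).alternating_series_le_tendsto (PhiA_summable hx).hasSum.tendsto_sum_nat m
  have hup : ∀ x : ℝ, 0 < x → ∀ m, F x ≤ P (2*m+1) x := fun x hx m =>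
    (hanti x).tendsto_le_alternating_series (PhiA_summable hx).hasSum.tendsto_sum_nat m
  have hP0 : Filter.Tendsto (fun m => P m 0) Filter.atTop (nhds (π/4)) := by
    have := Real.tendsto_sum_pi_div_four
    refine this.congr fun m => ?_
    simp only [hP]
    apply Finset.sum_congr rfl; intro k _; simp [div_eq_mul_inv]
  have hFt : Filter.Tendsto F (nhdsWithin 0 (Set.Ioi 0)) (nhds (π/4)) := by
    rw [tendsto_order]
    constructor
    · intro a ha
      have h1 : ∀ᶠ m : ℕ in Filter.atTop, a < P (2*m) 0 :=
        (hP0.comp (Filter.tendsto_atTop_mono (fun m : ℕ => by simp only [id]; omega) Filter.tendsto_id)).eventually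
          (lt_mem_nhds ha)
      obtain ⟨m, hm⟩ := h1.exists
      have h2 : ∀ᶠ x in nhds (0:ℝ), a < P (2*m) x :=
        (hPc (2*m)).continuousAt.eventually (lt_mem_nhds hm)
      filter_upwards [nhdsWithin_le_nhds h2, self_mem_nhdsWithin] with x hx1 hx2
      exact hx1.trans_le (hlow x hx2 m)
    · intro a ha
      have h1 : ∀ᶠ m : ℕ in Filter.atTop, P (2*m+1) 0 < a :=
        (hP0.comp (Filter.tendsto_atTop_mono (fun m : ℕ => by simp only [id]; omega) Filter.tendsto_id)).eventually
          (gt_mem_nhds ha)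
      obtain ⟨m, hm⟩ := h1.exists
      have h2 : ∀ᶠ x in nhds (0:ℝ), P (2*m+1) x < a :=
        (hPc (2*m+1)).continuousAt.eventually (gt_mem_nhds hm)
      filter_upwards [nhdsWithin_le_nhds h2, self_mem_nhdsWithin] with x hx1 hx2
      exact (hup x hx2 m).trans_lt hx1
  have := hFt.const_mul (-(4/π))
  rw [show -(4/π) * (π/4) = -1 by field_simp] at this
  exact this

lemma cell_err {L : ℝ} (hL : 0 < L) (hlip : ∀ x y : ℝ, 0 < x → x ≤ y →
    |phiDensity y - phiDensity x| ≤ L / (1+x)^2 * (y - x)) {a d : ℝ} (ha : 0 < a) (hd : 0 < d) :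
    |2 * d * phiDensity (a + d) - (PhiA (a + 2*d) - PhiA a)| ≤ 6 * d^2 * L / (1+a)^2 := by
  obtain ⟨ξ, hξ, hs⟩ := exists_hasDerivAt_eq_slope PhiA phiDensity (show a < a + 2*d by linarith)
    (fun t ht => (PhiA_deriv (ha.trans_le ht.1)).continuousAt.continuousWithinAt)
    (fun t ht => PhiA_deriv (ha.trans ht.1))
  have e : PhiA (a + 2*d) - PhiA a = 2 * d * phiDensity ξ := by
    rw [hs]; field_simp; ring
  rw [e, ← mul_sub, abs_mul, abs_of_pos (by positivity)]
  have h1 := hlip a (a+d) ha (by linarith)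
  have h2 := hlip a ξ ha hξ.1.le
  have hK : 0 < L / (1+a)^2 := by positivity
  have h3 : |phiDensity (a+d) - phiDensity ξ| ≤ L / (1+a)^2 * (3 * d) := by
    have := abs_sub_le (phiDensity (a+d)) (phiDensity a) (phiDensity ξ)
    rw [abs_sub_comm (phiDensity a)] at this
    have h4 : L / (1+a)^2 * (ξ - a) ≤ L / (1+a)^2 * (2*d) := by
      apply mul_le_mul_of_nonneg_left _ hK.le; linarith [hξ.2]
    have h5 : a + d - a = d := by ring
    rw [h5] at h1
    linarith
  calc _ ≤ 2 * d * (L / (1+a)^2 * (3*d)) := by gcongr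
    _ = _ := by ring

lemma riemann : ∃ K : ℝ, 0 < K ∧ ∀ d : ℝ, 0 < d → d ≤ 1 → ∀ p m : ℕ, p ≤ 1 →
    |∑ i ∈ Finset.range (m+1), 2 * d * phiDensity (((p:ℝ) + 2 * i + 1) * d)
      - (PhiA (((p:ℝ) + 2 * m + 2) * d) - PhiA (((p:ℝ)+2) * d))| ≤ K * d := by
  obtain ⟨L, hL, hlip⟩ := phi_lip
  refine ⟨2 * (|phiDensity 2| + 2 * L) + 6 * L, by positivity, fun d hd hd1 p m hp => ?_⟩
  have hp' : (p:ℝ) ≤ 1 := by exact_mod_cast hp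
  have hp0 : (0:ℝ) ≤ p := by positivity
  rw [Finset.sum_range_succ']
  set A : ℕ → ℝ := fun i => PhiA (((p:ℝ) + 2 * i + 2) * d) with hA
  have htel : PhiA (((p:ℝ) + 2 * m + 2) * d) - PhiA (((p:ℝ)+2) * d)
      = ∑ i ∈ Finset.range m, (A (i+1) - A i) := by
    rw [Finset.sum_range_sub]; simp [hA]
  rw [htel, add_sub_right_comm, ← Finset.sum_sub_distrib]
  have h0 : |2 * d * phiDensity (((p:ℝ) + 2 * ((0:ℕ):ℝ) + 1) * d)|
      ≤ 2 * (|phiDensity 2| + 2 * L) * d := by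
    rw [abs_mul, abs_of_pos (by positivity : 0 < 2 * d)]
    set x := ((p:ℝ) + 2 * ((0:ℕ):ℝ) + 1) * d with hx
    have hx0 : 0 < x := by positivity
    have hx2 : x ≤ 2 := by
      rw [hx]; push_cast; nlinarith
    have h1 := hlip x 2 hx0 hx2
    have h2 : L / (1+x)^2 * (2 - x) ≤ 2 * L := by
      calc L / (1+x)^2 * (2 - x) ≤ L * 2 := by
            apply mul_le_mul _ (by linarith) (by linarith) hL.le
            apply div_le_self hL.le
            nlinarith
        _ = 2 * L := by ring
    have h3 : |phiDensity x| ≤ |phiDensity 2| + 2 * L := by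
      have := abs_sub_abs_le_abs_sub (phiDensity x) (phiDensity 2)
      rw [abs_sub_comm] at this
      linarith
    calc 2 * d * |phiDensity x| ≤ 2 * d * (|phiDensity 2| + 2 * L) := by gcongr
      _ = _ := by ring
  have hterm : ∀ i ∈ Finset.range m,
      |2 * d * phiDensity (((p:ℝ) + 2 * ((i+1:ℕ):ℝ) + 1) * d) - (A (i+1) - A i)|
      ≤ 6 * L * d * (1 / (1 + d * ((i:ℝ))) - 1 / (1 + d * ((i:ℝ)+1))) := by
    intro i _
    have ha : 0 < ((p:ℝ) + 2 * i + 2) * d := by positivity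
    have h := cell_err hL hlip ha hd
    have e1 : ((p:ℝ) + 2 * ((i+1:ℕ):ℝ) + 1) * d = ((p:ℝ) + 2 * i + 2) * d + d := by push_cast; ring
    have e2 : A (i+1) = PhiA (((p:ℝ) + 2 * i + 2) * d + 2 * d) := by
      simp only [hA]; congr 1; push_cast; ring
    rw [e1, e2]
    refine h.trans ?_
    have e3 : 6 * L * d * (1 / (1 + d * ((i:ℝ))) - 1 / (1 + d * ((i:ℝ)+1)))
       = 6 * d^2 * L / ((1 + d * i) * (1 + d * (i+1))) := by
      field_simp; ring
    rw [e3]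
    apply div_le_div_of_nonneg_left (by positivity) (by positivity)
    rw [sq]
    have hi : (0:ℝ) ≤ i := by positivity
    apply mul_le_mul _ _ (by positivity) (by positivity) <;> nlinarith
  have hsum : |∑ i ∈ Finset.range m,
      (2 * d * phiDensity (((p:ℝ) + 2 * ((i+1:ℕ):ℝ) + 1) * d) - (A (i+1) - A i))| ≤ 6 * L * d := by
    refine (Finset.abs_sum_le_sum_abs _ _).trans ((Finset.sum_le_sum hterm).trans ?_)
    rw [← Finset.mul_sum]
    have := sum_le_hasSum (Finset.range m) (fun i _ => by
      rw [sub_nonneg]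
      apply one_div_le_one_div_of_le (by positivity)
      nlinarith) (hasSum_tele hd)
    calc _ ≤ 6 * L * d * 1 := by gcongr
      _ = _ := by ring
  refine (abs_add_le _ _).trans ?_
  linarith

lemma tsum_V (n : ℕ) : ∑' h : ℕ, (V n h : ℝ)
    = ∑ i ∈ Finset.range (n/2+1), (V n (n%2 + 2*i) : ℝ) := by
  have hinj : Function.Injective (fun i : ℕ => n%2 + 2*i) := fun a b hab => by
    simp only at hab; omega
  rw [← hinj.tsum_eq]
  · apply tsum_eq_sum
    intro i hi
    simp only [Finset.mem_range, not_lt] at hi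
    rw [V_eq_zero_of n _ (Or.inr (by omega))]; simp
  · intro h hh
    by_contra hn
    apply hh
    show (V n h : ℝ) = 0
    rw [V_eq_zero_of n h]
    · simp
    · by_contra hc
      push Not at hc
      apply hn
      exact ⟨h/2, by simp only; omega⟩

lemma T_est : ∃ K : ℝ, 0 < K ∧ ∀ n : ℕ, 1 ≤ n →
    |Real.sqrt n * ((∑' h : ℕ, (V n h : ℝ)) / 2^n) - Real.sqrt (2*π) / 2 *
      (PhiA (((n:ℝ)+2) / Real.sqrt n) - PhiA ((((n%2:ℕ):ℝ)+2) / Real.sqrt n))| ≤ K / Real.sqrt n := by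
  obtain ⟨K, hK, hR⟩ := riemann
  have hpi := Real.pi_pos
  refine ⟨Real.sqrt (2*π) / 2 * K + 1209600, by positivity, fun n hn => ?_⟩
  have hn1 : (1:ℝ) ≤ n := by exact_mod_cast hn
  have hn' : (0:ℝ) < n := by linarith
  set s := Real.sqrt n with hs
  have hs0 : 0 < s := Real.sqrt_pos.2 hn'
  have hss : (n:ℝ) = s^2 := (Real.sq_sqrt hn'.le).symm
  have hs1 : 1 ≤ s := by rw [hs]; exact Real.one_le_sqrt.2 hn1
  have h1 := hR (1/s) (by positivity) (by rw [div_le_one hs0]; exact hs1) (n%2) (n/2) (by omega)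
  have e0 : (((n%2:ℕ):ℝ) + 2 * ((n/2:ℕ):ℝ) + 2) * (1/s) = ((n:ℝ)+2)/s := by
    have : (n%2) + 2 * (n/2) = n := by omega
    have h2 : ((n%2:ℕ):ℝ) + 2 * ((n/2:ℕ):ℝ) = n := by exact_mod_cast this
    rw [h2]; ring
  rw [e0, show (((n%2:ℕ):ℝ) + 2) * (1/s) = (((n%2:ℕ):ℝ) + 2)/s by ring] at h1
  set D := PhiA (((n:ℝ)+2) / s) - PhiA ((((n%2:ℕ):ℝ)+2) / s) with hD
  rw [tsum_V, Finset.sum_div]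
  have h2 : |∑ i ∈ Finset.range (n/2+1), ((V n (n%2 + 2*i) : ℝ) / 2^n) -
      ∑ i ∈ Finset.range (n/2+1), Real.sqrt (2*π) / n * phiDensity ((((n%2:ℕ):ℝ) + 2 * i + 1) * (1/s))|
      ≤ 1209600 / n := by
    rw [← Finset.sum_sub_distrib]
    refine (Finset.abs_sum_le_sum_abs _ _).trans ?_
    have : ∀ i ∈ Finset.range (n/2+1), |(V n (n%2 + 2*i) : ℝ) / 2^n -
        Real.sqrt (2*π) / n * phiDensity ((((n%2:ℕ):ℝ) + 2 * i + 1) * (1/s))| ≤ 604800 / (n:ℝ)^2 := by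
      intro i _
      have := V_phi n (n%2+2*i) hn (by omega)
      push_cast at this
      rw [← hs] at this
      rw [mul_one_div]
      exact_mod_cast this
    refine (Finset.sum_le_sum this).trans ?_
    rw [Finset.sum_const, Finset.card_range, nsmul_eq_mul]
    have hM : ((n/2+1:ℕ):ℝ) ≤ 2 * n := by
      have : n/2+1 ≤ 2*n := by omega
      exact_mod_cast this
    calc _ ≤ 2 * (n:ℝ) * (604800 / (n:ℝ)^2) := by gcongr
      _ = 1209600 / n := by field_simp; norm_num
  set X := ∑ i ∈ Finset.range (n/2+1), ((V n (n%2 + 2*i) : ℝ) / 2^n) with hX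
  set Y := ∑ i ∈ Finset.range (n/2+1), 2 * (1/s) * phiDensity ((((n%2:ℕ):ℝ) + 2 * i + 1) * (1/s)) with hY
  have e1 : ∑ i ∈ Finset.range (n/2+1), Real.sqrt (2*π) / n * phiDensity ((((n%2:ℕ):ℝ) + 2 * i + 1) * (1/s))
     = Real.sqrt (2*π) / 2 / s * Y := by
    rw [hY, ← Finset.mul_sum, ← Finset.mul_sum, ← mul_assoc]
    congr 1
    rw [hss]; field_simp
  rw [e1] at h2
  have h3 : |s * X - Real.sqrt (2*π)/2 * Y| ≤ 1209600 / s := by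
    have : s * X - Real.sqrt (2*π)/2 * Y = s * (X - Real.sqrt (2*π) / 2 / s * Y) := by
      field_simp
    rw [this, abs_mul, abs_of_pos hs0]
    calc _ ≤ s * (1209600 / n) := by gcongr
      _ = _ := by rw [hss]; field_simp
  have h4 : |Real.sqrt (2*π)/2 * Y - Real.sqrt (2*π)/2 * D| ≤ Real.sqrt (2*π)/2 * K / s := by
    rw [← mul_sub, abs_mul, abs_of_pos (by positivity)]
    calc _ ≤ Real.sqrt (2*π)/2 * (K * (1/s)) := by gcongr
      _ = _ := by ring
  calc _ ≤ _ := abs_sub_le _ (Real.sqrt (2*π)/2 * Y) _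
    _ ≤ 1209600 / s + Real.sqrt (2*π)/2 * K / s := add_le_add h3 h4
    _ = _ := by ring

lemma tendsto_sqrt_nat : Filter.Tendsto (fun n : ℕ => Real.sqrt (n:ℝ)) Filter.atTop Filter.atTop :=
  Real.tendsto_sqrt_atTop.comp tendsto_natCast_atTop_atTop

lemma T_lim : Filter.Tendsto (fun n : ℕ => Real.sqrt n * ((∑' h : ℕ, (V n h : ℝ)) / 2^n))
    Filter.atTop (nhds (Real.sqrt (2*π) / 2)) := by
  obtain ⟨K, hK, hT⟩ := T_est
  have hpi := Real.pi_pos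
  have hinv : ∀ c : ℝ, Filter.Tendsto (fun n : ℕ => c / Real.sqrt (n:ℝ)) Filter.atTop (nhds 0) :=
    fun c => tendsto_const_nhds.div_atTop tendsto_sqrt_nat
  have hA : Filter.Tendsto (fun n : ℕ => PhiA (((n:ℝ)+2) / Real.sqrt n)) Filter.atTop (nhds 0) := by
    have h1 := hinv (2 * (600 * S2))
    refine squeeze_zero_norm' ?_ h1
    filter_upwards [Filter.eventually_ge_atTop 1] with n hn
    have hn' : (0:ℝ) < n := by exact_mod_cast hn
    have hs0 : 0 < Real.sqrt n := Real.sqrt_pos.2 hn'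
    have hS := S2_nonneg
    refine (PhiA_bound (by positivity)).trans ?_
    gcongr
    rw [le_div_iff₀ hs0, Real.mul_self_sqrt hn'.le]
    linarith
  have hB : Filter.Tendsto (fun n : ℕ => PhiA ((((n%2:ℕ):ℝ)+2) / Real.sqrt n)) Filter.atTop (nhds (-1)) := by
    apply PhiA_zero.comp
    rw [tendsto_nhdsWithin_iff]
    constructor
    · refine squeeze_zero (fun n => by positivity) (fun n => ?_) (hinv 3)
      have h1 : n%2 ≤ 1 := by omega
      have : ((n%2:ℕ):ℝ) ≤ 1 := by exact_mod_cast h1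
      gcongr
      linarith
    · filter_upwards [Filter.eventually_ge_atTop 1] with n hn
      have hn' : (0:ℝ) < n := by exact_mod_cast hn
      have hs0 : 0 < Real.sqrt n := Real.sqrt_pos.2 hn'
      simp only [Set.mem_Ioi]
      positivity
  have hC := ((hA.sub hB).const_mul (Real.sqrt (2*π)/2))
  rw [show Real.sqrt (2*π)/2 * (0 - -1) = Real.sqrt (2*π)/2 by ring] at hC
  have hdiff : Filter.Tendsto (fun n : ℕ => Real.sqrt n * ((∑' h : ℕ, (V n h : ℝ)) / 2^n) -
      Real.sqrt (2*π) / 2 *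
      (PhiA (((n:ℝ)+2) / Real.sqrt n) - PhiA ((((n%2:ℕ):ℝ)+2) / Real.sqrt n))) Filter.atTop (nhds 0) := by
    refine squeeze_zero_norm' ?_ (hinv K)
    filter_upwards [Filter.eventually_ge_atTop 1] with n hn
    exact hT n hn
  simpa using hdiff.add hC

lemma phi_lower {l η : ℝ} (hl : 0 < l) (h1 : 3 / Real.sqrt l < η) (h2 : η < Real.sqrt l / 2) :
    Real.exp (-(l/4)) ≤ 2 * phiDensity η := by
  have hpi := Real.pi_pos
  have hsl : 0 < Real.sqrt l := Real.sqrt_pos.2 hl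
  have hη : 0 < η := lt_trans (by positivity) h1
  have hsq : Real.sqrt l ^2 = l := Real.sq_sqrt hl.le
  rcases le_total 1 η with h | h
  · have hG := Gt_lower (a := η^2/2) (by nlinarith)
    rw [phi_eq_Gt]
    have e1 : Real.exp (-(l/4)) ≤ Real.exp (-(η^2/2)) := by
      apply Real.exp_le_exp.2
      nlinarith
    have e2 : 1 ≤ 4 * η / π := by
      rw [le_div_iff₀ hpi]; linarith [Real.pi_lt_four]
    have e3 := Real.exp_pos (-(η^2/2))
    nlinarith
  · have ha : π^2 / (8 * η^2) ≤ l / 4 := by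
      rw [div_lt_iff₀ hsl] at h1
      have h9 : 9 < η^2 * l := by
        rw [← hsq]; nlinarith
      rw [div_le_div_iff₀ (by positivity) (by norm_num)]
      have := Real.pi_lt_four
      nlinarith
    have hG := Gt_lower (a := π^2 / (8 * η^2)) (by
      rw [le_div_iff₀ (by positivity)]
      nlinarith [Real.pi_gt_three])
    rw [phi_dual hη]
    have e1 : Real.exp (-(l/4)) ≤ Real.exp (-(π^2 / (8 * η^2))) := Real.exp_le_exp.2 (by linarith)
    have e2 : 1 ≤ Real.sqrt (2*π) / η^2 := by
      rw [le_div_iff₀ (by positivity)]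
      have : 1 ≤ Real.sqrt (2*π) := Real.one_le_sqrt.2 (by linarith [Real.pi_gt_three])
      nlinarith
    have e3 := Real.exp_pos (-(π^2 / (8 * η^2)))
    nlinarith

theorem height_local_limit :
    ∀ ε > (0 : ℝ), ∃ N : ℕ, ∀ n : ℕ, N ≤ n → ∀ h : ℕ, h % 2 = n % 2 →
      3 / Real.sqrt (Real.log n) < (h : ℝ) / Real.sqrt n →
      (h : ℝ) / Real.sqrt n < Real.sqrt (Real.log n) / 2 →
      |Real.sqrt n * ((V n h : ℝ) / ∑' h' : ℕ, (V n h' : ℝ)) /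
          (2 * phiDensity ((h : ℝ) / Real.sqrt n)) - 1| < ε := by
  intro ε hε
  obtain ⟨L, hL, hlip⟩ := phi_lip
  have hpi := Real.pi_pos
  set q := Real.sqrt (2*π) with hq
  have hq0 : 0 < q := Real.sqrt_pos.2 (by positivity)
  have hQ := T_lim
  rw [← hq] at hQ
  set Q : ℕ → ℝ := fun n => Real.sqrt n * ((∑' h : ℕ, (V n h : ℝ)) / 2^n) with hQd
  have hev1 : ∀ᶠ n in Filter.atTop, q/4 < Q n := hQ.eventually (lt_mem_nhds (by linarith))
  have hratio : Filter.Tendsto (fun n => (q/2) / Q n) Filter.atTop (nhds 1) := by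
    have := (tendsto_const_nhds (x := q/2)).div hQ (by positivity)
    rwa [div_self (by positivity)] at this
  have hev2 : ∀ᶠ n in Filter.atTop, |(q/2) / Q n - 1| < ε/2 := by
    have := (Metric.tendsto_nhds.1 hratio) (ε/2) (by positivity)
    simpa [Real.dist_eq] using this
  set K := q * L + 604800 with hK
  have hK0 : 0 < K := by positivity
  have hexp : Filter.Tendsto (fun n : ℕ => (K * 4 / q) * Real.exp (-(Real.log n / 4)))
      Filter.atTop (nhds 0) := by
    have h1 : Filter.Tendsto (fun n : ℕ => Real.log n / 4) Filter.atTop Filter.atTop :=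
      (Real.tendsto_log_atTop.comp tendsto_natCast_atTop_atTop).atTop_div_const (by norm_num)
    have := (Real.tendsto_exp_neg_atTop_nhds_zero.comp h1).const_mul (K * 4 / q)
    simpa using this
  have hev3 : ∀ᶠ n : ℕ in Filter.atTop, (K * 4 / q) * Real.exp (-(Real.log n / 4)) < ε/2 :=
    hexp.eventually (gt_mem_nhds (by positivity))
  obtain ⟨N, hN⟩ := Filter.eventually_atTop.1
    ((hev1.and (hev2.and hev3)).and (Filter.eventually_ge_atTop 2))
  refine ⟨N, fun n hn h hpar hlo hhi => ?_⟩
  obtain ⟨⟨hq1, hq2, hq3⟩, hn2⟩ := hN n hn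
  have hn1 : (1:ℝ) < n := by exact_mod_cast hn2
  have hn' : (0:ℝ) < n := by linarith
  have hl : 0 < Real.log n := Real.log_pos hn1
  have hφ := phi_lower hl hlo hhi
  set s := Real.sqrt n with hs
  have hs0 : 0 < s := Real.sqrt_pos.2 hn'
  have hss : (n:ℝ) = s^2 := (Real.sq_sqrt hn'.le).symm
  have hs1 : 1 ≤ s := Real.one_le_sqrt.2 hn1.le
  set η := (h:ℝ)/s with hη
  have hη0 : 0 < η := lt_trans (by positivity) hlo
  have hE := Real.exp_pos (-(Real.log n / 4))
  have hsE : 1 / s = Real.exp (-(Real.log n / 4)) * Real.exp (-(Real.log n / 4)) := by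
    have : s = Real.exp (Real.log n / 2) := by
      rw [hs, Real.sqrt_eq_rpow, Real.rpow_def_of_pos hn']; congr 1; ring
    rw [← Real.exp_add, this, one_div, ← Real.exp_neg]; congr 1; ring
  set E := Real.exp (-(Real.log n / 4)) with hEd
  have hV := V_phi n h (by omega) hpar
  rw [← hq, ← hs] at hV
  have hη' : ((h:ℝ)+1)/s = η + 1/s := by rw [hη]; ring
  rw [hη'] at hV
  have hli := hlip η (η + 1/s) hη0 (by have : 0 < 1/s := by positivity
                                       linarith)
  have hli2 : |phiDensity (η + 1/s) - phiDensity η| ≤ L / s := by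
    refine hli.trans ?_
    rw [add_sub_cancel_left, mul_one_div]
    gcongr
    apply div_le_self hL.le
    nlinarith
  set v := (V n h : ℝ)/2^n with hv
  set φ := phiDensity η with hφd
  have hφ0 : 0 < φ := by linarith
  have he : |n * v - q * φ| ≤ K / s := by
    have e1 : n * v - q * φ = n * (v - q / n * phiDensity (η + 1/s)) +
        q * (phiDensity (η + 1/s) - φ) := by field_simp; ring
    rw [e1]
    refine (abs_add_le _ _).trans ?_
    rw [abs_mul, abs_mul, abs_of_pos hn', abs_of_pos hq0]
    calc _ ≤ n * (604800 / (n:ℝ)^2) + q * (L / s) := by gcongr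
      _ = 604800 / s^2 + q * L / s := by rw [hss]; field_simp
      _ ≤ 604800 / s + q * L / s := by
          gcongr
          nlinarith
      _ = K / s := by rw [hK]; ring
  have hQ0 : 0 < Q n := by linarith
  have hT : (∑' h' : ℕ, (V n h' : ℝ)) = Q n * 2^n / s := by
    simp only [hQd]; rw [← hs]; field_simp
  have hmain : s * ((V n h : ℝ) / ∑' h' : ℕ, (V n h' : ℝ)) / (2 * φ) - 1
      = ((q/2) / Q n - 1) + (n * v - q * φ) / (2 * φ * Q n) := by
    rw [hT, hv, hss]
    field_simp
    ring
  rw [hmain]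
  have h5 : |(n * v - q * φ) / (2 * φ * Q n)| ≤ (K * 4 / q) * E := by
    rw [abs_div, abs_of_pos (by positivity : 0 < 2 * φ * Q n), div_le_iff₀ (by positivity)]
    refine he.trans ?_
    have h6 : E * (q/4) ≤ 2 * φ * Q n := by
      apply mul_le_mul hφ hq1.le (by positivity) (by positivity)
    calc K / s = K * (1/s) := by ring
      _ = K * 4 / q * E * (E * (q/4)) := by rw [hsE]; field_simp
      _ ≤ K * 4 / q * E * (2 * φ * Q n) := by gcongr
  calc _ ≤ _ := abs_add_le _ _
    _ < ε/2 + ε/2 := by linarith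
    _ = ε := by ring
end

section
/- Fix K > 0. For a positive integer N set m = N/2 and υ_{h,k} = (h+2)(2k+1)/2. Then, as N → ∞, Σ_{h,k ≥ 0, h ≡ N (mod 2)} ((2υ_{h,k}² − m)/m) · exp(−υ_{h,k}²/m) = √(mπ)/4 + O(m^{−K}), where the double sum converges absolutely. -/
open Real

/-- `υ_{h,k} = (h+2)(2k+1)/2`. -/
noncomputable def upsHK (h k : ℕ) : ℝ := ((h : ℝ) + 2) * (2 * (k : ℝ) + 1) / 2

/-- Summand of the harmonic sum (4.2), `j = r = 0` case: for pairs `(h,k)` with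
`h ≡ N (mod 2)`, `((2υ_{h,k}² − m)/m) exp(−υ_{h,k}²/m)` with `m = N/2`. -/
noncomputable def upsSummand0 (N : ℕ) (p : ℕ × ℕ) : ℝ :=
  if p.1 % 2 = N % 2 then
    (2 * upsHK p.1 p.2 ^ 2 - (N : ℝ) / 2) / ((N : ℝ) / 2) *
      Real.exp (-(upsHK p.1 p.2 ^ 2 / ((N : ℝ) / 2)))
  else 0

lemma ups_sq_bound (a s : ℝ) (hs : s ∈ Set.Icc (-1:ℝ) 2) {C : ℝ} (hC : 0 ≤ C) :
    C / (1 + (a + s)^2) ≤ 9 * C * (1 + a^2)⁻¹ := by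
  rw [← div_eq_mul_inv, div_le_div_iff₀ (by positivity) (by positivity)]
  have h1 : s ^ 2 ≤ 4 := by nlinarith [hs.1, hs.2]
  have : 1 + a^2 ≤ 9 * (1 + (a+s)^2) := by nlinarith [sq_nonneg (a + 2 * s)]
  nlinarith

lemma ups_summable_int : Summable (fun a : ℤ => (1 + (a:ℝ)^2)⁻¹) := by
  have h := (Real.summable_one_div_int_pow (p := 2)).mpr (by norm_num)
  refine Summable.of_norm_bounded_eventually (g := fun a : ℤ => 1 / (a:ℝ)^2) h ?_
  have : ({0}ᶜ : Set ℤ) ∈ Filter.cofinite := (Set.finite_singleton (0:ℤ)).compl_mem_cofinite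
  filter_upwards [this] with a ha
  have ha' : (a:ℝ) ≠ 0 := by exact_mod_cast ha
  rw [Real.norm_of_nonneg (by positivity), one_div]
  have : 0 < (a:ℝ)^2 := by positivity
  gcongr
  linarith

lemma ups_integrable {u : ℝ → ℝ} (hc : Continuous u) {C : ℝ}
    (bu : ∀ x, |u x| ≤ C / (1 + x^2)) : MeasureTheory.Integrable u := by
  refine (integrable_inv_one_add_sq.const_mul C).mono' hc.aestronglyMeasurable ?_
  filter_upwards with x
  simpa [div_eq_mul_inv] using bu x

lemma ups_summ {u : ℝ → ℝ} {C : ℝ} (bu : ∀ x, |u x| ≤ C / (1 + x^2)) (s : ℝ)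
    (hs : s ∈ Set.Icc (-1:ℝ) 2) : Summable (fun a : ℤ => u (a + s)) := by
  have hC : 0 ≤ C := by have := (abs_nonneg _).trans (bu 0); simpa using this
  refine Summable.of_norm_bounded (g := fun a : ℤ => 9 * C * (1 + (a:ℝ)^2)⁻¹)
    (ups_summable_int.mul_left _) ?_
  intro a
  exact (bu _).trans (ups_sq_bound a s hs hC)

lemma ups_step {u v : ℝ → ℝ} {C : ℝ} (hu : ∀ x, HasDerivAt u (v x) x)
    (bu : ∀ x, |u x| ≤ C / (1 + x^2)) (bv : ∀ x, |v x| ≤ C / (1 + x^2)) {M : ℝ}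
    (hM : ∀ s ∈ Set.Icc (0:ℝ) 1, |∑' a : ℤ, v (a + s)| ≤ M) :
    ∀ s ∈ Set.Icc (0:ℝ) 1, |(∑' a : ℤ, u (a + s)) - ∫ x, u x| ≤ M := by
  have hC : 0 ≤ C := by have := (abs_nonneg _).trans (bu 0); simpa using this
  have hcu : Continuous u := continuous_iff_continuousAt.mpr fun x => (hu x).continuousAt
  have hS : Summable (fun a : ℤ => 9 * C * (1 + (a:ℝ)^2)⁻¹) := ups_summable_int.mul_left _
  have hsub : ∀ s ∈ Set.Icc (0:ℝ) 1, s ∈ Set.Ioo (-1:ℝ) 2 := fun s hs =>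
    ⟨by linarith [hs.1], by linarith [hs.2]⟩
  have hder : ∀ s ∈ Set.Icc (0:ℝ) 1,
      HasDerivAt (fun s : ℝ => ∑' a : ℤ, u (a + s)) (∑' a : ℤ, v (a + s)) s := by
    intro s hs
    refine hasDerivAt_tsum_of_isPreconnected (g := fun (a : ℤ) (s : ℝ) => u (a + s))
      (g' := fun (a : ℤ) (s : ℝ) => v (a + s)) (y₀ := 0) (t := Set.Ioo (-1:ℝ) 2)
      hS isOpen_Ioo isPreconnected_Ioo ?_ ?_ ⟨by norm_num, by norm_num⟩ ?_ (hsub s hs)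
    · intro a y hy
      exact HasDerivAt.comp_const_add (a:ℝ) y (hu _)
    · intro a y hy
      exact (bv _).trans (ups_sq_bound a y ⟨hy.1.le, hy.2.le⟩ hC)
    · exact ups_summ bu 0 ⟨by norm_num, by norm_num⟩
  set A : ℝ → ℝ := fun s => ∑' a : ℤ, u (a + s) with hA
  have hM0 : 0 ≤ M := (abs_nonneg _).trans (hM 0 ⟨le_rfl, zero_le_one⟩)
  have hlip : ∀ x ∈ Set.Icc (0:ℝ) 1, ∀ y ∈ Set.Icc (0:ℝ) 1, |A y - A x| ≤ M := by
    intro x hx y hy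
    have := Convex.norm_image_sub_le_of_norm_hasDerivWithin_le (f := A)
      (f' := fun s => ∑' a : ℤ, v (a + s)) (C := M)
      (fun s hs => (hder s hs).hasDerivWithinAt) hM (convex_Icc 0 1) hx hy
    refine this.trans ?_
    have h2 : ‖y - x‖ ≤ 1 := by
      rw [Real.norm_eq_abs, abs_le]; constructor <;> linarith [hx.1, hx.2, hy.1, hy.2]
    nlinarith
  have hint : ∫ x, u x = ∫ s in (0:ℝ)..1, A s := by
    have h1 := (ups_integrable hcu bu).hasSum_intervalIntegral_comp_add_int
    have h2 : HasSum (fun n : ℤ => ∫ x in (0:ℝ)..1, u (x + n)) (∫ s in (0:ℝ)..1, A s) := by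
      refine intervalIntegral.hasSum_integral_of_dominated_convergence
        (fun (a : ℤ) _ => 9 * C * (1 + (a:ℝ)^2)⁻¹) ?_ ?_ ?_ ?_ ?_
      · intro a; fun_prop
      · intro a; filter_upwards with t ht
        rw [Set.uIoc_of_le zero_le_one] at ht
        rw [add_comm]
        exact (bu _).trans (ups_sq_bound a t ⟨by linarith [ht.1], by linarith [ht.2]⟩ hC)
      · filter_upwards with t ht using hS
      · simp
      · filter_upwards with t ht
        rw [Set.uIoc_of_le zero_le_one] at ht
        have : HasSum (fun a : ℤ => u (a + t)) (A t) :=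
          (ups_summ bu t ⟨by linarith [ht.1], by linarith [ht.2]⟩).hasSum
        simpa only [add_comm] using this
    exact h1.unique h2
  have hcA : ContinuousOn A (Set.Icc 0 1) := fun s hs => (hder s hs).continuousAt.continuousWithinAt
  intro s hs
  have e : A s - ∫ x, u x = ∫ x in (0:ℝ)..1, (A s - A x) := by
    rw [intervalIntegral.integral_sub (by simp) (hcA.intervalIntegrable_of_Icc zero_le_one), hint]
    simp
  change |A s - ∫ x, u x| ≤ M
  rw [e]
  have := intervalIntegral.norm_integral_le_of_norm_le_const (a := (0:ℝ)) (b := 1)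
    (f := fun x => A s - A x) (C := M) (by
      intro x hx
      rw [Set.uIoc_of_le zero_le_one] at hx
      exact hlip x ⟨hx.1.le, hx.2⟩ s hs)
  simpa using this

/-- Riemann sums of flat functions. -/
lemma ups_riemann (f : ℕ → ℝ → ℝ) (hf : ∀ j x, HasDerivAt (f j) (f (j+1) x) x)
    (bf : ∀ j, ∃ C, ∀ x, |f j x| ≤ C / (1 + x^2)) (K : ℕ) :
    ∃ C, 0 ≤ C ∧ ∀ δ : ℝ, 0 < δ → δ ≤ 1 →
      |(∑' a : ℤ, f 0 (a * δ)) - δ⁻¹ * ∫ x, f 0 x| ≤ C * δ^K := by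
  choose C hC using bf
  have hC0 : ∀ j, 0 ≤ C j := fun j => by have := (abs_nonneg _).trans (hC j 0); simpa using this
  set B : ℝ := ∑' a : ℤ, 9 * (C (K+3)) * (1 + (a:ℝ)^2)⁻¹ with hB
  have hB0 : 0 ≤ B := tsum_nonneg fun a => by have := hC0 (K+3); positivity
  refine ⟨B, hB0, ?_⟩
  intro δ hδ hδ1
  set u : ℕ → ℝ → ℝ := fun j x => δ^j * f j (x * δ) with hu
  have du : ∀ j x, HasDerivAt (u j) (u (j+1) x) x := by
    intro j x
    have h1 := ((hf j (x*δ)).comp x ((hasDerivAt_id x).mul_const δ)).const_mul (δ^j)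
    refine h1.congr_deriv ?_
    simp only [hu]; ring
  have bu : ∀ j x, |u j x| ≤ (C j * δ^j / δ^2) / (1 + x^2) := by
    intro j x
    simp only [hu]
    rw [abs_mul, abs_of_pos (by positivity : 0 < δ^j), div_div, mul_comm (C j), mul_div_assoc]
    refine mul_le_mul_of_nonneg_left ((hC j _).trans ?_) (by positivity)
    apply div_le_div_of_nonneg_left (hC0 j) (by positivity)
    nlinarith [sq_nonneg x]
  have key : ∀ i j, i + j = K + 3 → 1 ≤ j → ∀ s ∈ Set.Icc (0:ℝ) 1,
      |∑' a : ℤ, u j (a + s)| ≤ B * δ^(K+1) := by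
    intro i
    induction i with
    | zero =>
      intro j hj _ s hs
      have hj : j = K + 3 := by omega
      subst hj
      have hs' : s ∈ Set.Icc (-1:ℝ) 2 := ⟨by linarith [hs.1], by linarith [hs.2]⟩
      have hb : ∀ a : ℤ, ‖u (K+3) (a+s)‖ ≤ (9 * (C (K+3)) * (1 + (a:ℝ)^2)⁻¹) * δ^(K+1) := by
        intro a
        have h3 := hC0 (K+3)
        refine (bu _ _).trans ((ups_sq_bound a s hs' (by positivity)).trans (le_of_eq ?_))
        field_simp
        ring
      have hsm : Summable fun a : ℤ => (9 * (C (K+3)) * (1 + (a:ℝ)^2)⁻¹) * δ^(K+1) :=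
        (ups_summable_int.mul_left _).mul_right _
      have := tsum_of_norm_bounded hsm.hasSum hb
      rwa [tsum_mul_right] at this
    | succ i ih =>
      intro j hj h1 s hs
      have h0 : ∫ x, u j x = 0 := by
        obtain ⟨l, rfl⟩ : ∃ l, j = l + 1 := ⟨j - 1, by omega⟩
        refine MeasureTheory.integral_eq_zero_of_hasDerivAt_of_integrable (du l) ?_ ?_
        · exact ups_integrable (continuous_iff_continuousAt.mpr
            fun x => (du _ x).continuousAt) (bu _)
        · exact ups_integrable (continuous_iff_continuousAt.mpr
            fun x => (du _ x).continuousAt) (bu _)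
      have := ups_step (u := u j) (v := u (j+1))
        (C := max (C j * δ^j / δ^2) (C (j+1) * δ^(j+1) / δ^2)) (du j)
        (fun x => (bu j x).trans (by gcongr; exact le_max_left _ _))
        (fun x => (bu (j+1) x).trans (by gcongr; exact le_max_right _ _))
        (ih (j+1) (by omega) (by omega)) s hs
      rwa [h0, sub_zero] at this
  have fin := ups_step (u := u 0) (v := u 1)
        (C := max (C 0 * δ^0 / δ^2) (C 1 * δ^1 / δ^2)) (du 0)
        (fun x => (bu 0 x).trans (by gcongr; exact le_max_left _ _))
        (fun x => (bu 1 x).trans (by gcongr; exact le_max_right _ _))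
        (key (K+2) 1 (by omega) le_rfl) 0 ⟨le_rfl, zero_le_one⟩
  have e : ∫ x, u 0 x = δ⁻¹ * ∫ x, f 0 x := by
    simp only [hu, pow_zero, one_mul]
    rw [MeasureTheory.Measure.integral_comp_mul_right]
    simp [abs_of_pos hδ]
  rw [e] at fin
  simp only [hu, pow_zero, one_mul, add_zero] at fin
  refine fin.trans (mul_le_mul_of_nonneg_left ?_ hB0)
  exact pow_le_pow_of_le_one hδ.le hδ1 (by omega)

/-- theta summand -/
noncomputable def upsG (k : ℕ) (z : ℂ) : ℂ := z * Complex.exp (-(z^2 * ((k:ℂ) + 1/2)^2))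

/-- theta function -/
noncomputable def upsTheta (z : ℂ) : ℂ := ∑' k : ℕ, upsG k z

lemma upsG_norm (k : ℕ) (z : ℂ) :
    ‖upsG k z‖ = ‖z‖ * Real.exp (-((z^2).re * ((k:ℝ) + 1/2)^2)) := by
  rw [upsG, norm_mul, Complex.norm_exp]
  congr 2
  have : ((k:ℂ) + 1/2)^2 = (((k:ℝ) + 1/2)^2 : ℝ) := by push_cast; ring
  rw [this, Complex.neg_re, Complex.re_mul_ofReal]

lemma ups_exp_le {y : ℝ} (hy : 0 < y) (M : ℕ) : Real.exp (-y) ≤ (M.factorial : ℝ) / y^M := by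
  rw [Real.exp_neg, inv_le_comm₀ (Real.exp_pos _) (by positivity), inv_div]
  exact Real.pow_div_factorial_le_exp y hy.le M

lemma ups_summable_nat (M : ℕ) (hM : 1 ≤ M) :
    Summable (fun k : ℕ => (((k:ℝ) + 1/2)^(2*M))⁻¹) := by
  have h := (Real.summable_one_div_nat_pow (p := 2)).mpr (by norm_num)
  have h := ((summable_nat_add_iff 1).mpr h).mul_left ((2:ℝ)^(2*M))
  refine Summable.of_nonneg_of_le (fun k => by positivity) (fun k => ?_) h
  have h1 : ((k:ℝ)+1)^2 ≤ ((k:ℝ)+1)^(2*M) := pow_le_pow_right₀ (by linarith [(Nat.cast_nonneg k : (0:ℝ) ≤ k)]) (by omega)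
  have h2 : ((k:ℝ)+1)^(2*M) ≤ 2^(2*M) * ((k:ℝ)+1/2)^(2*M) := by
    rw [← mul_pow]
    gcongr
    linarith [(Nat.cast_nonneg k : (0:ℝ) ≤ k)]
  rw [inv_le_comm₀ (by positivity) (by positivity)]
  push_cast
  rw [mul_one_div, inv_div, div_le_iff₀ (by positivity)]
  linarith

lemma ups_exp_summable {r : ℝ} (hr : 0 < r) :
    Summable (fun k : ℕ => Real.exp (-(r * ((k:ℝ) + 1/2)^2))) := by
  refine Summable.of_nonneg_of_le (fun k => by positivity) (fun k => ?_)
    ((ups_summable_nat 1 le_rfl).mul_left r⁻¹)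
  have := ups_exp_le (y := r * ((k:ℝ) + 1/2)^2) (by positivity) 1
  refine this.trans (le_of_eq ?_)
  simp [mul_comm]

lemma upsTheta_large (M : ℕ) (hM : 1 ≤ M) : ∃ C, 0 ≤ C ∧ ∀ z : ℂ, 0 < (z^2).re →
    ‖upsTheta z‖ ≤ C * ‖z‖ / ((z^2).re)^M := by
  refine ⟨∑' k : ℕ, (M.factorial : ℝ) * (((k:ℝ) + 1/2)^(2*M))⁻¹,
    tsum_nonneg fun k => by positivity, fun z hz => ?_⟩
  have hs := (((ups_summable_nat M hM).mul_left (M.factorial : ℝ)).mul_right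
    (‖z‖ / ((z^2).re)^M))
  have := tsum_of_norm_bounded (f := fun k => upsG k z) hs.hasSum (fun k => by
    rw [upsG_norm]
    have h1 := ups_exp_le (y := (z^2).re * ((k:ℝ) + 1/2)^2) (by positivity) M
    refine (mul_le_mul_of_nonneg_left h1 (norm_nonneg z)).trans (le_of_eq ?_)
    rw [mul_pow, ← pow_mul]
    field_simp)
  rw [tsum_mul_right] at this
  rw [mul_div_assoc]
  exact this

lemma upsTheta_deriv {z : ℂ} (hz : 0 < (z^2).re) : DifferentiableAt ℂ upsTheta z ∧
    HasSum (fun k => deriv (upsG k) z) (deriv upsTheta z) := by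
  set U : Set ℂ := {w | (z^2).re / 2 < (w^2).re ∧ ‖w‖ < ‖z‖ + 1} with hU
  have hUo : IsOpen U := by
    apply IsOpen.inter
    · exact isOpen_lt (f := fun _ : ℂ => (z^2).re / 2) (g := fun w : ℂ => (w^2).re)
        continuous_const (Complex.continuous_re.comp (continuous_pow 2))
    · exact isOpen_lt (f := fun w : ℂ => ‖w‖) (g := fun _ : ℂ => ‖z‖ + 1)
        continuous_norm continuous_const
  have hzU : z ∈ U := ⟨by linarith, by linarith⟩
  have hsum : Summable (fun k : ℕ => (‖z‖ + 1) * Real.exp (-((z^2).re / 2 * ((k:ℝ) + 1/2)^2))) :=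
    (ups_exp_summable (by positivity)).mul_left _
  have hd : ∀ k : ℕ, DifferentiableOn ℂ (upsG k) U := by
    intro k
    unfold upsG
    fun_prop
  have hb : ∀ (k : ℕ), ∀ w ∈ U, ‖upsG k w‖ ≤
      (‖z‖ + 1) * Real.exp (-((z^2).re / 2 * ((k:ℝ) + 1/2)^2)) := by
    intro k w hw
    rw [upsG_norm]
    gcongr
    · exact hw.2.le
    · exact hw.1.le
  exact ⟨(Complex.differentiableOn_tsum_of_summable_norm hsum hd hUo hb).differentiableAt
    (hUo.mem_nhds hzU), Complex.hasSum_deriv_of_summable_norm hsum hd hUo hb hzU⟩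

lemma upsG_deriv_re (k : ℕ) (t : ℝ) : (deriv (upsG k) (t:ℂ)).re =
    -((2 * (t * ((k:ℝ)+1/2))^2 - 1) * Real.exp (-(t * ((k:ℝ)+1/2))^2)) := by
  have h : HasDerivAt (upsG k) (1 * Complex.exp (-((t:ℂ)^2 * ((k:ℂ) + 1/2)^2)) +
      (t:ℂ) * (Complex.exp (-((t:ℂ)^2 * ((k:ℂ) + 1/2)^2)) *
        (-((2:ℕ) * (t:ℂ)^(2-1) * 1 * ((k:ℂ) + 1/2)^2)))) (t:ℂ) := by
    exact (hasDerivAt_id (t:ℂ)).mul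
      ((((hasDerivAt_id (t:ℂ)).pow 2).mul_const (((k:ℂ) + 1/2)^2)).neg.cexp)
  rw [h.deriv]
  have e : (1 * Complex.exp (-((t:ℂ)^2 * ((k:ℂ) + 1/2)^2)) +
      (t:ℂ) * (Complex.exp (-((t:ℂ)^2 * ((k:ℂ) + 1/2)^2)) *
        (-((2:ℕ) * (t:ℂ)^(2-1) * 1 * ((k:ℂ) + 1/2)^2)))) =
      ((-((2 * (t * ((k:ℝ)+1/2))^2 - 1) * Real.exp (-(t * ((k:ℝ)+1/2))^2)) : ℝ) : ℂ) := by
    push_cast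
    rw [mul_pow]
    simp
    ring
  rw [e, Complex.ofReal_re]

lemma upsTheta_eq {z : ℂ} (hz : 0 < (z^2).re) (hz1 : 0 < z.re) :
    2 * upsTheta z = (√π : ℝ) * jacobiTheta (1 + Complex.I * π / z^2) := by
  have hz0 : z ≠ 0 := by rintro rfl; simp at hz1
  have hpi : (π : ℂ) ≠ 0 := by exact_mod_cast Real.pi_ne_zero
  have hsq : ((√π : ℝ) : ℂ)^2 = π := by
    rw [← Complex.ofReal_pow, Real.sq_sqrt Real.pi_pos.le]
  have ha : ((π:ℂ) / z^2) = (((√π : ℝ) : ℂ) / z)^2 := by rw [div_pow, hsq]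
  have hre : 0 < (((√π : ℝ) : ℂ) / z).re := by
    rw [div_eq_mul_inv, Complex.re_ofReal_mul, Complex.inv_re]
    have := Complex.normSq_pos.mpr hz0
    have := Real.sqrt_pos.mpr Real.pi_pos
    positivity
  have hare : 0 < ((π:ℂ) / z^2).re := by
    rw [div_eq_mul_inv, Complex.re_ofReal_mul, Complex.inv_re]
    have := Complex.normSq_pos.mpr (pow_ne_zero 2 hz0)
    have := Real.pi_pos
    positivity
  have P := Complex.tsum_exp_neg_quadratic hare (-Complex.I / 2)
  have hcp : ((π:ℂ) / z^2) ^ (1/2 : ℂ) = ((√π : ℝ) : ℂ) / z := by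
    rw [ha, one_div, Complex.sq_cpow_two_inv hre]
  rw [hcp] at P
  have hsp : ((√π : ℝ) : ℂ) ≠ 0 := by
    have := Real.sqrt_pos.mpr Real.pi_pos
    exact_mod_cast this.ne'
  have hl : ∑' n : ℤ, Complex.exp (-(π:ℂ) * ((π:ℂ) / z^2) * (n:ℂ)^2 +
      2 * π * (-Complex.I/2) * n) = jacobiTheta (1 + Complex.I * π / z^2) := by
    rw [jacobiTheta]
    congr 1; ext n
    rw [Complex.exp_eq_exp_iff_exists_int]
    obtain ⟨l, hl⟩ : ∃ l : ℤ, n^2 + n = 2 * l := by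
      obtain ⟨l, hl⟩ := Int.even_mul_succ_self n
      exact ⟨l, by linarith⟩
    have hl' : (n:ℂ)^2 + n = 2 * l := by exact_mod_cast hl
    refine ⟨-l, ?_⟩
    field_simp
    push_cast
    ring_nf
    simp only [Complex.I_sq]
    linear_combination (-Complex.I * z^2) * hl'
  have hr : ∑' n : ℤ, Complex.exp (-(π:ℂ) / ((π:ℂ) / z^2) * ((n:ℂ) + Complex.I * (-Complex.I/2))^2)
      * z = 2 * upsTheta z := by
    have hf : ∀ n : ℤ, Complex.exp (-(π:ℂ) / ((π:ℂ) / z^2) *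
        ((n:ℂ) + Complex.I * (-Complex.I/2))^2) * z =
        z * Complex.exp (-(z^2 * ((n:ℂ) + 1/2)^2)) := by
      intro n
      have : Complex.I * (-Complex.I/2) = 1/2 := by
        linear_combination (-1/2) * Complex.I_sq
      rw [this, mul_comm]
      congr 2
      field_simp
    simp_rw [hf]
    have hsumm : Summable (fun k : ℕ => upsG k z) := by
      refine Summable.of_norm ?_
      simp_rw [upsG_norm]
      exact (ups_exp_summable hz).mul_left _
    have hneg : ∀ k : ℕ, z * Complex.exp (-(z^2 * (((-((k:ℤ)+1) : ℤ) : ℂ) + 1/2)^2)) = upsG k z := by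
      intro k
      rw [upsG]; congr 3; push_cast; ring
    rw [tsum_of_nat_of_neg_add_one]
    · simp_rw [hneg]
      have : ∀ k : ℕ, z * Complex.exp (-(z^2 * (((k:ℤ) : ℂ) + 1/2)^2)) = upsG k z := by
        intro k; simp [upsG]
      simp_rw [this]
      rw [← upsTheta]; ring
    · refine hsumm.congr fun k => ?_
      simp [upsG]
    · refine hsumm.congr fun k => (hneg k).symm
  rw [hl] at P
  rw [tsum_mul_right] at hr
  rw [P, ← hr]
  generalize (∑' n : ℤ, Complex.exp (-(π:ℂ) / ((π:ℂ) / z^2) *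
    ((n:ℂ) + Complex.I * (-Complex.I/2))^2)) = X
  field_simp

lemma upsTheta_small (M : ℕ) (hM : 1 ≤ M) : ∃ C, 0 ≤ C ∧ ∀ z : ℂ, 0 < (z^2).re → 0 < z.re →
    ‖((√π / 2 : ℝ) : ℂ) - upsTheta z‖ ≤ C / (((z^2)⁻¹).re)^M := by
  refine ⟨√π * (M.factorial : ℝ) / (π^2)^M, by positivity, fun z hz hz1 => ?_⟩
  have hz0 : z ≠ 0 := by rintro rfl; simp at hz1
  have hw : 0 < ((z^2)⁻¹).re := by
    rw [Complex.inv_re]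
    have := Complex.normSq_pos.mpr (pow_ne_zero 2 hz0)
    positivity
  set w := ((z^2)⁻¹).re with hwd
  set τ : ℂ := 1 + Complex.I * π / z^2 with hτ
  have him : τ.im = π * w := by
    rw [hτ, div_eq_mul_inv, mul_assoc, Complex.add_im, Complex.I_mul_im, Complex.re_ofReal_mul]
    simp [hwd]
  have hpos : 0 < τ.im := by rw [him]; have := Real.pi_pos; positivity
  have hb := norm_jacobiTheta_sub_one_le hpos
  have e : ((√π / 2 : ℝ) : ℂ) - upsTheta z = ((-(√π / 2) : ℝ) : ℂ) * (jacobiTheta τ - 1) := by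
    have := upsTheta_eq hz hz1
    push_cast
    linear_combination (-1/2) * this
  rw [e, norm_mul, Complex.norm_real, norm_neg, Real.norm_of_nonneg (by positivity)]
  set y := π^2 * w with hy
  have hy0 : 0 < y := by have := Real.pi_pos; positivity
  have hyy : -π * τ.im = -y := by rw [him, hy]; ring
  rw [hyy] at hb
  have hexp : y^M / (M.factorial : ℝ) ≤ Real.exp y - 1 := by
    have := Real.sum_le_exp_of_nonneg hy0.le (M+1)
    have h2 : 1 + y^M / (M.factorial : ℝ) ≤ ∑ i ∈ Finset.range (M+1), y^i / (i.factorial : ℝ) := by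
      rw [Finset.sum_range_succ]
      gcongr
      have := Finset.single_le_sum (f := fun i => y^i / (i.factorial : ℝ)) (s := Finset.range M)
        (fun i _ => by positivity) (Finset.mem_range.mpr (by omega : 0 < M))
      simpa using this
    linarith
  have hp : 0 < y^M / (M.factorial : ℝ) := by positivity
  have e2 : 2 / (1 - Real.exp (-y)) * Real.exp (-y) = 2 / (Real.exp y - 1) := by
    rw [Real.exp_neg]
    have h1 : Real.exp y - 1 ≠ 0 := by linarith
    have h2 := (Real.exp_pos y).ne'
    field_simp
  rw [e2] at hb
  calc √π / 2 * ‖jacobiTheta τ - 1‖ ≤ √π / 2 * (2 / (Real.exp y - 1)) := by gcongr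
    _ ≤ √π / 2 * (2 / (y^M / (M.factorial : ℝ))) := by gcongr
    _ = _ := by rw [hy, mul_pow]; field_simp

/-- shifted theta -/
noncomputable def upsH (z : ℂ) : ℂ := ((√π / 2 : ℝ) : ℂ) - upsTheta z

lemma ups_disk {t : ℝ} (ht : 0 < t) {z : ℂ} (hz : ‖z - t‖ ≤ t / 4) :
    0 < z.re ∧ t^2 / 2 ≤ (z^2).re ∧ ‖z‖ ≤ 5 / 4 * t ∧ (1/5) / t^2 ≤ ((z^2)⁻¹).re := by
  have h1 := (Complex.abs_re_le_norm (z - t)).trans hz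
  have h2 := (Complex.abs_im_le_norm (z - t)).trans hz
  simp only [Complex.sub_re, Complex.sub_im, Complex.ofReal_re, Complex.ofReal_im, sub_zero] at h1 h2
  rw [abs_le] at h1 h2
  have hre : 3 / 4 * t ≤ z.re := by linarith [h1.1]
  have hn : ‖z‖ ≤ 5 / 4 * t := by
    have : ‖z‖ ≤ ‖z - t‖ + ‖(t:ℂ)‖ := by simpa using norm_add_le (z - t) (t:ℂ)
    rw [Complex.norm_real, Real.norm_of_nonneg ht.le] at this
    linarith
  have hsq : t^2 / 2 ≤ (z^2).re := by
    rw [sq z, Complex.mul_re]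
    nlinarith [h2.1, h2.2]
  refine ⟨by linarith, hsq, hn, ?_⟩
  have hz0 : z ≠ 0 := by rintro rfl; simp at hre; linarith
  rw [Complex.inv_re, Complex.normSq_eq_norm_sq, norm_pow]
  have hp : 0 < ‖z‖ := norm_pos_iff.mpr hz0
  rw [div_le_div_iff₀ (by positivity) (by positivity)]
  have h4 : (‖z‖^2)^2 ≤ ((5/4*t)^2)^2 := by gcongr
  have h5 : t^2/2 * t^2 ≤ (z^2).re * t^2 := by gcongr
  nlinarith [pow_pos ht 4]

lemma ups_diffcont {t : ℝ} (ht : 0 < t) {f : ℂ → ℂ}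
    (hf : ∀ z : ℂ, 0 < (z^2).re → DifferentiableAt ℂ f z) :
    DiffContOnCl ℂ f (Metric.ball (t:ℂ) (t/4)) := by
  apply DifferentiableOn.diffContOnCl
  intro z hz
  have hz' := Metric.closure_ball_subset_closedBall hz
  rw [Metric.mem_closedBall, dist_eq_norm] at hz'
  have h := (ups_disk ht hz').2.1
  exact (hf z (by have := pow_pos ht 2; linarith)).differentiableWithinAt

lemma upsH_diff (z : ℂ) (hz : 0 < (z^2).re) : DifferentiableAt ℂ upsH z :=
  (upsTheta_deriv hz).1.const_sub _

lemma upsH_small (j L : ℕ) : ∃ C, 0 ≤ C ∧ ∀ t : ℝ, 0 < t → t ≤ 1 →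
    ‖iteratedDeriv j upsH (t:ℂ)‖ ≤ C * t^L := by
  obtain ⟨C, hC, h⟩ := upsTheta_small (L + j + 1) (by omega)
  refine ⟨j.factorial * (C * 5^(L+j+1)) * 4^j, by positivity, fun t ht ht1 => ?_⟩
  have := Complex.norm_iteratedDeriv_le_of_forall_mem_sphere_norm_le j
    (by positivity : 0 < t/4) (ups_diffcont ht upsH_diff)
    (C := C * 5^(L+j+1) * t^(L+j)) (by
      intro z hz
      rw [Metric.mem_sphere, dist_eq_norm] at hz
      obtain ⟨h1, h2, h3, h4⟩ := ups_disk ht hz.le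
      have ht2 := pow_pos ht 2
      refine (h z (by linarith) h1).trans ?_
      have h5 : C / (((z^2)⁻¹).re)^(L+j+1) ≤ C / ((1/5) / t^2)^(L+j+1) := by gcongr
      refine h5.trans ?_
      have e : C / ((1/5) / t^2)^(L+j+1) = C * 5^(L+j+1) * (t^2)^(L+j+1) := by
        rw [div_pow, div_pow]; field_simp
        try simp
      rw [e]
      refine mul_le_mul_of_nonneg_left ?_ (by positivity)
      rw [← pow_mul]
      exact pow_le_pow_of_le_one ht.le ht1 (by omega))
  refine this.trans (le_of_eq ?_)
  rw [div_pow, pow_add t]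
  field_simp

lemma upsH_large (j : ℕ) : ∃ C, 0 ≤ C ∧ ∀ t : ℝ, 1 ≤ t →
    ‖iteratedDeriv (j+1) upsH (t:ℂ)‖ ≤ C / t^2 := by
  obtain ⟨C, hC, h⟩ := upsTheta_large 2 (by omega)
  refine ⟨(j+1).factorial * (C * (5/4) * 4) * 4^(j+1), by positivity, fun t ht1 => ?_⟩
  have ht : 0 < t := by linarith
  have e : iteratedDeriv (j+1) upsH (t:ℂ) = - iteratedDeriv (j+1) upsTheta (t:ℂ) := by
    have hd : deriv upsH = - deriv upsTheta := by
      funext z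
      exact deriv_const_sub _
    rw [iteratedDeriv_succ', iteratedDeriv_succ', hd, iteratedDeriv_neg]
  rw [e, norm_neg]
  have := Complex.norm_iteratedDeriv_le_of_forall_mem_sphere_norm_le (j+1)
    (by positivity : 0 < t/4) (ups_diffcont ht (fun z hz => (upsTheta_deriv hz).1))
    (C := C * (5/4) * 4 / t^3) (by
      intro z hz
      rw [Metric.mem_sphere, dist_eq_norm] at hz
      obtain ⟨h1, h2, h3, h4⟩ := ups_disk ht hz.le
      have ht2 := pow_pos ht 2
      refine (h z (by linarith)).trans ?_
      calc C * ‖z‖ / ((z^2).re)^2 ≤ C * (5/4*t) / (t^2/2)^2 := by gcongr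
        _ = _ := by field_simp; try norm_num)
  refine this.trans ?_
  rw [div_pow, div_div_eq_mul_div]
  have e3 : ((j+1).factorial : ℝ) * (C * (5/4) * 4 / t^3) * 4^(j+1) / t^(j+1) =
    ((j+1).factorial * (C * (5/4) * 4) * 4^(j+1)) / (t^3 * t^(j+1)) := by field_simp
  rw [e3]
  apply div_le_div_of_nonneg_left (by positivity) (by positivity)
  rw [← pow_add]
  exact pow_le_pow_right₀ ht1 (by omega)

/-- real family -/
noncomputable def upsQ (j : ℕ) (x : ℝ) : ℝ :=
  if 0 < x then (iteratedDeriv j upsH (x:ℂ)).re else 0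

lemma upsQ_small (j L : ℕ) : ∃ C, 0 ≤ C ∧ ∀ t : ℝ, |t| ≤ 1 → |upsQ j t| ≤ C * |t|^L := by
  obtain ⟨C, hC, h⟩ := upsH_small j L
  refine ⟨C, hC, fun t ht => ?_⟩
  rw [upsQ]
  split_ifs with h0
  · rw [abs_of_pos h0] at ht ⊢
    exact (Complex.abs_re_le_norm _).trans (h t h0 ht)
  · simp; positivity

lemma upsQ_bound (j : ℕ) : ∃ C, ∀ t : ℝ, |upsQ (j+1) t| ≤ C / (1 + t^2) := by
  obtain ⟨C, hC, h⟩ := upsQ_small (j+1) 0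
  obtain ⟨D, hD, h'⟩ := upsH_large j
  refine ⟨2 * (C + D), fun t => ?_⟩
  rw [le_div_iff₀ (by positivity)]
  rcases le_or_gt |t| 1 with h1 | h1
  · have := h t h1
    rw [pow_zero, mul_one] at this
    have ht : t^2 ≤ 1 := by rw [← sq_abs]; nlinarith [abs_nonneg t]
    nlinarith [abs_nonneg (upsQ (j+1) t)]
  · rw [upsQ]
    split_ifs with h0
    · rw [abs_of_pos h0] at h1
      have := (Complex.abs_re_le_norm _).trans (h' t h1.le)
      rw [le_div_iff₀ (by positivity)] at this
      have ht2 : 1 ≤ t^2 := by nlinarith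
      have h3 := mul_le_mul_of_nonneg_left ht2 (abs_nonneg ((iteratedDeriv (j+1) upsH (t:ℂ)).re))
      linarith
    · simp; positivity

lemma upsQ_deriv (j : ℕ) (x : ℝ) : HasDerivAt (upsQ j) (upsQ (j+1) x) x := by
  rcases lt_trichotomy x 0 with hx | hx | hx
  · have e : upsQ (j+1) x = 0 := by rw [upsQ, if_neg (by linarith)]
    rw [e]
    refine (hasDerivAt_const x (0:ℝ)).congr_of_eventuallyEq ?_
    filter_upwards [Iio_mem_nhds hx] with y hy
    rw [upsQ, if_neg (by simp at hy; linarith)]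
  · subst hx
    have e : upsQ (j+1) 0 = 0 := by rw [upsQ, if_neg (by linarith)]
    have e0 : upsQ j 0 = 0 := by rw [upsQ, if_neg (by linarith)]
    rw [e]
    obtain ⟨C, hC, h⟩ := upsQ_small j 2
    have hO : (fun h : ℝ => upsQ j h) =O[nhds 0] fun h : ℝ => h^2 := by
      refine Asymptotics.IsBigO.of_bound C ?_
      filter_upwards [Metric.ball_mem_nhds (0:ℝ) one_pos] with y hy
      have hy' : |y| ≤ 1 := by simpa using (Metric.mem_ball.mp hy).le
      simpa using h y hy'
    have ho : (fun h : ℝ => h^2) =o[nhds 0] fun h : ℝ => h := by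
      simpa using Asymptotics.isLittleO_pow_id (𝕜 := ℝ) (n := 2) (by norm_num)
    rw [hasDerivAt_iff_isLittleO]
    simpa [e0] using hO.trans_isLittleO ho
  · have e : upsQ (j+1) x = (deriv (iteratedDeriv j upsH) (x:ℂ)).re := by
      rw [upsQ, if_pos hx, iteratedDeriv_succ]
    rw [e]
    have han : AnalyticAt ℂ upsH (x:ℂ) := by
      rw [Complex.analyticAt_iff_eventually_differentiableAt]
      have hc : ContinuousAt (fun z : ℂ => (z^2).re) (x:ℂ) :=
        (Complex.continuous_re.comp (continuous_pow 2)).continuousAt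
      have hp : 0 < (((x:ℂ))^2).re := by
        rw [← Complex.ofReal_pow, Complex.ofReal_re]; positivity
      filter_upwards [hc.eventually (lt_mem_nhds hp)] with z hz
      exact upsH_diff z hz
    have hd : DifferentiableAt ℂ (iteratedDeriv j upsH) (x:ℂ) := by
      rw [iteratedDeriv_eq_iterate]
      exact (han.iterated_deriv j).differentiableAt
    refine hd.hasDerivAt.real_of_complex.congr_of_eventuallyEq ?_
    filter_upwards [lt_mem_nhds hx] with y hy
    rw [upsQ, if_pos hy]

lemma upsQ_integral : ∫ x, upsQ 1 x = √π / 2 := by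
  obtain ⟨C, hC⟩ := upsQ_bound 0
  have hc : Continuous (upsQ 1) := continuous_iff_continuousAt.mpr
    fun x => (upsQ_deriv 1 x).continuousAt
  have := MeasureTheory.integral_of_hasDerivAt_of_tendsto (m := 0) (n := √π/2) (upsQ_deriv 0)
    (ups_integrable hc hC) ?_ ?_
  · simpa using this
  · refine tendsto_const_nhds.congr' ?_
    filter_upwards [Filter.eventually_le_atBot (0:ℝ)] with x hx
    rw [upsQ, if_neg (by linarith)]
  · obtain ⟨D, hD, h⟩ := upsTheta_large 1 le_rfl
    have hT : Filter.Tendsto (fun t : ℝ => upsTheta (t:ℂ)) Filter.atTop (nhds 0) := by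
      have h1 : Filter.Tendsto (fun t : ℝ => D * t⁻¹) Filter.atTop (nhds 0) := by
        simpa using (tendsto_inv_atTop_zero (𝕜 := ℝ)).const_mul D
      refine squeeze_zero_norm' ?_ h1
      filter_upwards [Filter.eventually_gt_atTop (0:ℝ)] with t ht
      have hp : (((t:ℂ))^2).re = t^2 := by
        rw [← Complex.ofReal_pow, Complex.ofReal_re]
      have := h t (by rw [hp]; positivity)
      rw [hp, Complex.norm_real, Real.norm_of_nonneg ht.le] at this
      refine this.trans (le_of_eq ?_)
      field_simp
    have h2 : Filter.Tendsto (fun t : ℝ => (((√π / 2 : ℝ) : ℂ) - upsTheta (t:ℂ)).re)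
        Filter.atTop (nhds (√π/2)) := by
      have := (Complex.continuous_re.tendsto _).comp
        ((tendsto_const_nhds (x := ((√π / 2 : ℝ) : ℂ))).sub hT)
      simpa [Function.comp_def] using this
    refine h2.congr' ?_
    filter_upwards [Filter.eventually_gt_atTop (0:ℝ)] with t ht
    rw [upsQ, if_pos ht, iteratedDeriv_zero, upsH]

lemma upsQ_hasSum {t : ℝ} (ht : 0 < t) : HasSum (fun k : ℕ =>
    (2 * (t * ((k:ℝ)+1/2))^2 - 1) * Real.exp (-(t * ((k:ℝ)+1/2))^2)) (upsQ 1 t) := by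
  have hp : 0 < (((t:ℂ))^2).re := by
    rw [← Complex.ofReal_pow, Complex.ofReal_re]; positivity
  have h := (Complex.hasSum_re (upsTheta_deriv hp).2).neg
  simp only [upsG_deriv_re, neg_neg] at h
  have this : deriv upsH (t:ℂ) = - deriv upsTheta (t:ℂ) := deriv_const_sub _
  have e : upsQ 1 t = -(deriv upsTheta (t:ℂ)).re := by
    rw [upsQ, if_pos ht, iteratedDeriv_one, this, Complex.neg_re]
  rw [e]
  exact h

lemma upsQ_T (K : ℕ) : ∃ C, 0 ≤ C ∧ ∀ δ : ℝ, 0 < δ → δ ≤ 1 →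
    Summable (fun a : ℕ => upsQ 1 (a * δ)) ∧
    |(∑' a : ℕ, upsQ 1 (a * δ)) - δ⁻¹ * (√π / 2)| ≤ C * δ^K := by
  obtain ⟨C, hC, h⟩ := ups_riemann (fun j => upsQ (j+1)) (fun j x => upsQ_deriv (j+1) x)
    upsQ_bound K
  refine ⟨C, hC, fun δ hδ hδ1 => ?_⟩
  obtain ⟨D, hD⟩ := upsQ_bound 0
  have hD0 : 0 ≤ D := by have := (abs_nonneg _).trans (hD 0); simpa using this
  have hs : Summable (fun a : ℤ => upsQ 1 (a * δ)) := by
    refine Summable.of_norm_bounded (g := fun a : ℤ => D / δ^2 * (1 + (a:ℝ)^2)⁻¹)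
      (ups_summable_int.mul_left _) fun a => (hD _).trans ?_
    rw [← div_eq_mul_inv, div_div]
    apply div_le_div_of_nonneg_left hD0 (by positivity)
    nlinarith [sq_nonneg (a:ℝ)]
  have hs1 : Summable (fun a : ℕ => upsQ 1 (a * δ)) := by
    simpa [Function.comp_def] using hs.comp_injective (Nat.cast_injective (R := ℤ))
  refine ⟨hs1, ?_⟩
  have hz : ∀ a : ℕ, upsQ 1 (((-((a:ℤ)+1) : ℤ) : ℝ) * δ) = 0 := by
    intro a
    rw [upsQ, if_neg]
    push_cast
    have : 0 ≤ ((a:ℝ)+1) * δ := by positivity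
    linarith
  have e : ∑' a : ℤ, upsQ 1 (a * δ) = ∑' a : ℕ, upsQ 1 (a * δ) := by
    rw [tsum_of_nat_of_neg_add_one (f := fun a : ℤ => upsQ 1 (a * δ)) (by simpa using hs1)
      (by simp only [hz]; exact summable_zero)]
    simp only [hz, tsum_zero, add_zero, Int.cast_natCast]
  have := h δ hδ hδ1
  simp only [zero_add] at this
  rwa [upsQ_integral, e] at this

lemma ups_summand_eq {N : ℕ} (hN : 0 < N) (h k : ℕ) (δ : ℝ) (hδ : δ = (√((N:ℝ)/2))⁻¹) :
    upsSummand0 N (h, k) = if h % 2 = N % 2 then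
      (2 * ((((h:ℝ)+2) * δ) * ((k:ℝ)+1/2))^2 - 1) *
        Real.exp (-((((h:ℝ)+2) * δ) * ((k:ℝ)+1/2))^2) else 0 := by
  have hm : 0 < (N:ℝ)/2 := by positivity
  have hd : δ^2 = ((N:ℝ)/2)⁻¹ := by rw [hδ, inv_pow, Real.sq_sqrt hm.le]
  rw [upsSummand0]
  simp only [upsHK]
  have e : ((((h:ℝ)+2) * δ) * ((k:ℝ)+1/2))^2 = (((h:ℝ)+2) * (2*(k:ℝ)+1)/2)^2 / ((N:ℝ)/2) := by
    rw [div_eq_mul_inv _ ((N:ℝ)/2), ← hd]; ring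
  rw [e]
  congr 2
  field_simp

lemma ups_g_bound {x : ℝ} (hx : 0 < x) :
    |(2 * x^2 - 1) * Real.exp (-x^2)| ≤ 5 * (x^2)⁻¹ := by
  have h1 := ups_exp_le (y := x^2) (by positivity) 1
  have h2 := ups_exp_le (y := x^2) (by positivity) 2
  rw [abs_mul, abs_of_pos (Real.exp_pos _)]
  have h3 : |2 * x^2 - 1| ≤ 2 * x^2 + 1 := by
    rw [abs_le]; constructor <;> nlinarith [sq_nonneg x]
  have hy : 0 < x^2 := by positivity
  simp only [Nat.factorial, pow_one] at h1 h2
  norm_num at h1 h2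
  calc |2 * x^2 - 1| * Real.exp (-x^2) ≤ (2 * x^2 + 1) * Real.exp (-x^2) := by gcongr
    _ = 2 * x^2 * Real.exp (-x^2) + Real.exp (-x^2) := by ring
    _ ≤ 2 * x^2 * (2 / (x^2)^2) + 1 / x^2 := by
        gcongr
        simpa using h1
    _ = 5 * (x^2)⁻¹ := by field_simp; norm_num

lemma ups_summand_summable {N : ℕ} (hN : 0 < N) :
    Summable (fun p : ℕ × ℕ => |upsSummand0 N p|) := by
  set δ : ℝ := (√((N:ℝ)/2))⁻¹ with hδ
  have hδ0 : 0 < δ := by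
    have : 0 < (N:ℝ)/2 := by positivity
    have := Real.sqrt_pos.mpr this
    positivity
  have hs := ups_summable_nat 1 le_rfl
  have hp := (hs.mul_of_nonneg hs (fun _ => by positivity) (fun _ => by positivity)).mul_left
    (5 * (δ^2)⁻¹)
  refine Summable.of_nonneg_of_le (fun p => abs_nonneg _) ?_ hp
  rintro ⟨h, k⟩
  rw [ups_summand_eq hN h k δ hδ]
  split_ifs
  · refine (ups_g_bound (by positivity)).trans ?_
    simp only [mul_one]
    rw [mul_pow, mul_pow, mul_inv, mul_inv]
    have : (((h:ℝ)+2)^2)⁻¹ ≤ (((h:ℝ)+1/2)^2)⁻¹ := by gcongr; norm_num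
    calc 5 * ((((h:ℝ)+2)^2)⁻¹ * (δ^2)⁻¹ * (((k:ℝ)+1/2)^2)⁻¹)
        ≤ 5 * ((((h:ℝ)+1/2)^2)⁻¹ * (δ^2)⁻¹ * (((k:ℝ)+1/2)^2)⁻¹) := by gcongr
      _ = _ := by ring
  · simp only [abs_zero]; positivity

lemma ups_parity (φ : ℕ → ℝ) (hφ : Summable φ) (h0 : φ 0 = 0) (N : ℕ) :
    (N % 2 = 0 → ∑' h : ℕ, (if h % 2 = N % 2 then φ (h+2) else 0) = ∑' k : ℕ, φ (2*k)) ∧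
    (N % 2 = 1 → ∑' h : ℕ, (if h % 2 = N % 2 then φ (h+2) else 0) =
      ∑' k : ℕ, φ k - ∑' k : ℕ, φ (2*k) - φ 1) := by
  have he : Summable (fun k => φ (2*k)) := hφ.comp_injective (fun a b h => by simpa using h)
  have ho : Summable (fun k => φ (2*k+1)) := hφ.comp_injective (fun a b h => by simpa using h)
  have he' : ∑' k, φ (2*k+2) = ∑' k, φ (2*k) := by
    rw [he.tsum_eq_zero_add]; simp [h0, mul_add]
  have ho' : ∑' k, φ (2*k+1+2) = ∑' k, φ (2*k+1) - φ 1 := by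
    rw [ho.tsum_eq_zero_add]; simp [mul_add]
  have hse : Summable (fun k => φ (2*k+2)) := (summable_nat_add_iff 1).mpr he
  have hso : Summable (fun k => φ (2*k+1+2)) := (summable_nat_add_iff 1).mpr ho
  have hsplit := tsum_even_add_odd he ho
  constructor
  · intro hN
    rw [hN, ← he', ← tsum_even_add_odd (f := fun h => if h % 2 = 0 then φ (h+2) else 0)]
    · simp [Nat.add_mod]
    · simpa using hse
    · simp [Nat.add_mod, summable_zero]
  · intro hN
    rw [hN, ← hsplit, add_sub_cancel_left, ← ho',
      ← tsum_even_add_odd (f := fun h => if h % 2 = 1 then φ (h+2) else 0)]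
    · simp [Nat.add_mod]
    · simp [summable_zero]
    · simpa [Nat.add_mod] using hso

/-- With `m = N/2`,
`Σ_{h,k≥0, h ≡ N (2)} ((2υ_{h,k}² − m)/m) exp(−υ_{h,k}²/m) = √(mπ)/4 + O(m^{−K})`,
the sum converging absolutely. -/
theorem ups_harmonic_sum_asymptotics_base (K : ℝ) (hK : 0 < K) :
    ∃ C > (0 : ℝ), ∃ N₀ : ℕ, ∀ N : ℕ, N₀ ≤ N →
      Summable (fun p : ℕ × ℕ => |upsSummand0 N p|) ∧
      |(∑' p : ℕ × ℕ, upsSummand0 N p) - Real.sqrt ((N : ℝ) / 2 * π) / 4| ≤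
        C * ((N : ℝ) / 2) ^ (-K) := by
  obtain ⟨n, hn⟩ := exists_nat_ge (2 * K)
  obtain ⟨C, hC, hT⟩ := upsQ_T n
  obtain ⟨D, hD, hF⟩ := upsQ_small 1 n
  refine ⟨C + C * 2^n + D + 1, by positivity, 8, fun N hN => ?_⟩
  have hN0 : 0 < N := by omega
  have hsum := ups_summand_summable hN0
  refine ⟨hsum, ?_⟩
  set m : ℝ := (N:ℝ)/2 with hm
  have hm4 : 4 ≤ m := by
    have : (8:ℝ) ≤ N := by exact_mod_cast hN
    rw [hm]; linarith
  have hm0 : 0 < m := by linarith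
  set δ : ℝ := (√m)⁻¹ with hδ
  have hsm : 2 ≤ √m := by
    rw [Real.le_sqrt (by norm_num) hm0.le]; linarith
  have hδ0 : 0 < δ := by positivity
  have hδ1 : δ ≤ 1 / 2 := by
    rw [hδ, one_div]; gcongr
  have hδi : δ⁻¹ = √m := by rw [hδ, inv_inv]
  have hpow : δ^n ≤ m^(-K) := by
    have e : δ^n = m^(-((n:ℝ)/2)) := by
      rw [hδ, Real.sqrt_eq_rpow, ← Real.rpow_neg hm0.le, ← Real.rpow_natCast, ← Real.rpow_mul hm0.le]
      congr 1; ring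
    rw [e]
    exact Real.rpow_le_rpow_of_exponent_le (by linarith) (by linarith)
  obtain ⟨s1, t1⟩ := hT δ hδ0 (by linarith)
  obtain ⟨s2, t2⟩ := hT (2*δ) (by linarith) (by linarith)
  have f1 := hF δ (by rw [abs_of_pos hδ0]; linarith)
  rw [abs_of_pos hδ0] at f1
  set φ : ℕ → ℝ := fun a => upsQ 1 (a * δ) with hφ
  have hφ0 : φ 0 = 0 := by simp [hφ, upsQ]
  have hφ1 : φ 1 = upsQ 1 δ := by simp [hφ]
  have hφ2 : ∑' k : ℕ, φ (2*k) = ∑' a : ℕ, upsQ 1 (a * (2*δ)) := by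
    congr 1; ext k; simp only [hφ]; congr 1; push_cast; ring
  have hS : ∑' p : ℕ × ℕ, upsSummand0 N p =
      ∑' h : ℕ, (if h % 2 = N % 2 then φ (h+2) else 0) := by
    rw [hsum.of_abs.tsum_prod]
    congr 1; ext h
    simp_rw [ups_summand_eq hN0 h _ δ (by rw [hδ, hm])]
    split_ifs with hh
    · have := (upsQ_hasSum (t := ((h:ℝ)+2)*δ) (by positivity)).tsum_eq
      rw [this]
      simp [hφ]
    · simp
  have hmain : √(m * π) / 4 = √m * √π / 4 := by rw [Real.sqrt_mul hm0.le]
  have i2 : (2*δ)⁻¹ = √m / 2 := by rw [mul_inv, hδi]; ring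
  rw [hδi] at t1
  rw [i2, ← hφ2, mul_pow] at t2
  rw [hS, hmain]
  have hδn : 0 < δ^n := by positivity
  have hfin : ∀ X : ℝ, |X| ≤ (C + C * 2^n + D + 1) * δ^n → |X| ≤ (C + C * 2^n + D + 1) * m^(-K) :=
    fun X hX => hX.trans (by gcongr)
  apply hfin
  have p1 : 0 ≤ C * δ^n := by positivity
  have p2 : 0 ≤ C * 2^n * δ^n := by positivity
  have p3 : 0 ≤ D * δ^n := by positivity
  rcases Nat.mod_two_eq_zero_or_one N with hpar | hpar
  · rw [(ups_parity φ s1 hφ0 N).1 hpar]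
    rw [abs_le] at t2 ⊢
    constructor <;> nlinarith [t2.1, t2.2]
  · rw [(ups_parity φ s1 hφ0 N).2 hpar, hφ1]
    rw [abs_le] at t1 t2 f1 ⊢
    constructor <;> nlinarith [t1.1, t1.2, t2.1, t2.2, f1.1, f1.2]
end
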